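/- arXiv:1904.07626 — 3 statements merged into one kernel-verified Lean document; each statement's English description precedes it below -/
import Mathlib

section
/- Let q ≥ 4 be a prime power. For 1 ≤ r ≤ 6 let d_r = min{ wt(D) : D an F-subspace of the Veronese code C_q with dim_F D = r } be the r-th generalized Hamming weight of C_q. Then d_1 = q^2 − q, d_2 = q^2 − 1, d_3 = q^2, d_4 = q^2 + q − 1, d_5 = q^2 + q, and d_6 = q^2 + q + 1. -/
noncomputable section

open MvPolynomial

/-- The projective plane over `F`: the projectivization of `F^3`. -/
abbrev Plane (F : Type*) [Field F] := Projectivization F (Fin 3 → F)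

/-- The Veronese code: evaluations of homogeneous degree-2 polynomials at the
chosen representatives of the points of the projective plane. -/
def VeroneseCode {F : Type*} [Field F] (rep : Plane F → (Fin 3 → F)) :
    Submodule F (Plane F → F) :=
  (MvPolynomial.homogeneousSubmodule (Fin 3) F 2).map
    (LinearMap.pi fun p => (MvPolynomial.aeval (rep p)).toLinearMap)

/-- The (Hamming) weight of a word: the size of its support. -/
def wt {α K : Type*} [Zero K] (g : α → K) : ℕ := Nat.card {p | g p ≠ 0}

/-- The weight of a subcode: the size of the union of supports of its elements. -/
def wtSub {F α : Type*} [Field F] (D : Submodule F (α → F)) : ℕ :=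
  Nat.card {p | ∃ c ∈ D, c p ≠ 0}

/-- The higher weight spectrum `A_w^(r)`: the number of subspaces of the Veronese
code of dimension `r` and weight `w`. -/
def hwSpectrum {F : Type*} [Field F] (rep : Plane F → (Fin 3 → F)) (r w : ℕ) : ℕ :=
  Nat.card {D : Submodule F (Plane F → F) //
    D ≤ VeroneseCode rep ∧ Module.finrank F ↥D = r ∧ wtSub D = w}

/-- The `r`-th generalized Hamming weight of the Veronese code. -/
def ghw {F : Type*} [Field F] (rep : Plane F → (Fin 3 → F)) (r : ℕ) : ℕ :=
  sInf {w | ∃ D : Submodule F (Plane F → F),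
    D ≤ VeroneseCode rep ∧ Module.finrank F ↥D = r ∧ wtSub D = w}


section Helpers

variable {F : Type*} [Field F]

/-- The quadratic form with coefficient vector `a`. -/
def qf (a : Fin 6 → F) (v : Fin 3 → F) : F :=
  a 0 * (v 0 * v 0) + a 1 * (v 1 * v 1) + a 2 * (v 2 * v 2) +
    a 3 * (v 0 * v 1) + a 4 * (v 0 * v 2) + a 5 * (v 1 * v 2)

/-- The polar form of `qf a`. -/
def bf (a : Fin 6 → F) (u v : Fin 3 → F) : F :=
  a 0 * (2 * u 0 * v 0) + a 1 * (2 * u 1 * v 1) + a 2 * (2 * u 2 * v 2) +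
    a 3 * (u 0 * v 1 + u 1 * v 0) + a 4 * (u 0 * v 2 + u 2 * v 0) +
    a 5 * (u 1 * v 2 + u 2 * v 1)

/-- `qf` as a linear functional in the coefficients. -/
def qL (v : Fin 3 → F) : (Fin 6 → F) →ₗ[F] F where
  toFun a := qf a v
  map_add' a b := by simp only [qf, Pi.add_apply]; ring
  map_smul' c a := by simp only [qf, Pi.smul_apply, smul_eq_mul, RingHom.id_apply]; ring

/-- `bf` as a linear functional in the coefficients. -/
def bL (u v : Fin 3 → F) : (Fin 6 → F) →ₗ[F] F where
  toFun a := bf a u v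
  map_add' a b := by simp only [bf, Pi.add_apply]; ring
  map_smul' c a := by simp only [bf, Pi.smul_apply, smul_eq_mul, RingHom.id_apply]; ring

lemma qf_smul (a : Fin 6 → F) (c : F) (v : Fin 3 → F) : qf a (c • v) = c ^ 2 * qf a v := by
  simp only [qf, Pi.smul_apply, smul_eq_mul]; ring

lemma qf_comb (a : Fin 6 → F) (u v w : Fin 3 → F) (s t r : F) :
    qf a (s • u + t • v + r • w) = s ^ 2 * qf a u + t ^ 2 * qf a v + r ^ 2 * qf a w +
      s * t * bf a u v + s * r * bf a u w + t * r * bf a v w := by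
  simp only [qf, bf, Pi.smul_apply, Pi.add_apply, smul_eq_mul]; ring

lemma qf_comb2 (a : Fin 6 → F) (u v : Fin 3 → F) (s t : F) :
    qf a (s • u + t • v) = s ^ 2 * qf a u + t ^ 2 * qf a v + s * t * bf a u v := by
  simp only [qf, bf, Pi.smul_apply, Pi.add_apply, smul_eq_mul]; ring

lemma qf_eq_zero (a : Fin 6 → F) (h : ∀ v, qf a v = 0) : a = 0 := by
  have h0 := h ![1, 0, 0]
  have h1 := h ![0, 1, 0]
  have h2 := h ![0, 0, 1]
  have h3 := h ![1, 1, 0]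
  have h4 := h ![1, 0, 1]
  have h5 := h ![0, 1, 1]
  simp [qf] at h0 h1 h2 h3 h4 h5
  simp [h0, h1, h2] at h3 h4 h5
  ext i
  fin_cases i <;> simp [*]

/-- The three vectors span the whole space. -/
def Gen (u v w : Fin 3 → F) : Prop := ∀ x, ∃ s t r : F, x = s • u + t • v + r • w

lemma Gen.eq_zero {u v w : Fin 3 → F} (h : Gen u v w) {a : Fin 6 → F}
    (h1 : qf a u = 0) (h2 : qf a v = 0) (h3 : qf a w = 0)
    (h4 : bf a u v = 0) (h5 : bf a u w = 0) (h6 : bf a v w = 0) : a = 0 := by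
  apply qf_eq_zero
  intro x
  obtain ⟨s, t, r, rfl⟩ := h x
  rw [qf_comb, h1, h2, h3, h4, h5, h6]; ring

lemma gen_of {u v w : Fin 3 → F} (hu : u ≠ 0) (hv : ∀ c : F, c • u ≠ v)
    (hw : ∀ s t : F, s • u + t • v ≠ w) : Gen u v w := by
  have h2 : LinearIndependent F ![u, v] := (LinearIndependent.pair_iff' hu).2 hv
  have h3 : LinearIndependent F ![w, u, v] := by
    refine linearIndependent_finCons.2 ⟨h2, ?_⟩
    intro hm
    have e : Set.range ![u, v] = {u, v} := by
      ext y; simp [Matrix.range_cons, or_comm]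
    have : w ∈ Submodule.span F {u, v} := by rwa [e] at hm
    obtain ⟨s, t, h⟩ := Submodule.mem_span_pair.1 this
    exact hw s t h
  have hs : ⊤ ≤ Submodule.span F (Set.range ![w, u, v]) :=
    (h3.span_eq_top_of_card_eq_finrank (by simp)).ge
  intro x
  have hx := hs (Submodule.mem_top (x := x))
  have : x ∈ Submodule.span F {w, u, v} := by
    have e : Set.range ![w, u, v] = {w, u, v} := by
      ext y; simp [Matrix.range_cons]; tauto
    rwa [e] at hx
  obtain ⟨r, s, t, h⟩ := Submodule.mem_span_triple.1 this
  exact ⟨s, t, r, by rw [← h]; abel⟩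

lemma exists_third (u v : Fin 3 → F) : ∃ w, ∀ s t : F, s • u + t • v ≠ w := by
  have h : Submodule.span F (Set.range ![u, v]) ≠ ⊤ := by
    intro h
    have h1 := finrank_range_le_card (R := F) (b := ![u, v])
    rw [Set.finrank, h] at h1
    simp at h1
  obtain ⟨w, hw⟩ := SetLike.exists_not_mem_of_ne_top _ h
  refine ⟨w, fun s t e => hw ?_⟩
  rw [← e]
  refine Submodule.add_mem _ (Submodule.smul_mem _ _ (Submodule.subset_span ⟨0, rfl⟩))
    (Submodule.smul_mem _ _ (Submodule.subset_span ⟨1, rfl⟩))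

lemma exists_second (u : Fin 3 → F) : ∃ v, ∀ c : F, c • u ≠ v := by
  obtain ⟨w, hw⟩ := exists_third u 0
  exact ⟨w, fun c => by simpa using hw c 0⟩

lemma vrank_le (E : Submodule F (Fin 6 → F)) {k : ℕ} (f : Fin k → ((Fin 6 → F) →ₗ[F] F))
    (h : ∀ a ∈ E, (∀ i, f i a = 0) → a = 0) : Module.finrank F E ≤ k := by
  have : Function.Injective ((LinearMap.pi f).comp E.subtype) := by
    rw [injective_iff_map_eq_zero]
    intro a ha
    have := h a a.2 (fun i => congrFun ha i)
    exact Subtype.ext this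
  simpa using LinearMap.finrank_le_finrank_of_injective this

/-- Parametrization of the code. -/
def Phi (rep : Plane F → (Fin 3 → F)) : (Fin 6 → F) →ₗ[F] (Plane F → F) :=
  LinearMap.pi fun p => qL (rep p)

/-- The polynomial with coefficients `a`. -/
def pol (a : Fin 6 → F) : MvPolynomial (Fin 3) F :=
  C (a 0) * (X 0 * X 0) + C (a 1) * (X 1 * X 1) + C (a 2) * (X 2 * X 2) +
    C (a 3) * (X 0 * X 1) + C (a 4) * (X 0 * X 2) + C (a 5) * (X 1 * X 2)

lemma eval_pol (a : Fin 6 → F) (v : Fin 3 → F) : eval v (pol a) = qf a v := by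
  simp [pol, qf]

lemma pol_hom (a : Fin 6 → F) : (pol a).IsHomogeneous 2 := by
  have h : ∀ (c : F) (i j : Fin 3), (C c * (X i * X j) : MvPolynomial (Fin 3) F).IsHomogeneous 2 :=
    fun c i j => (isHomogeneous_C _ c).mul ((isHomogeneous_X _ i).mul (isHomogeneous_X _ j))
  unfold pol
  exact (((((h _ _ _).add (h _ _ _)).add (h _ _ _)).add (h _ _ _)).add (h _ _ _)).add (h _ _ _)

lemma range_Phi (rep : Plane F → (Fin 3 → F)) : LinearMap.range (Phi rep) = VeroneseCode rep := by
  apply le_antisymm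
  · rintro _ ⟨a, rfl⟩
    refine ⟨pol a, pol_hom a, ?_⟩
    ext p
    simp only [LinearMap.pi_apply, Phi, AlgHom.toLinearMap_apply, qL, LinearMap.coe_mk,
      AddHom.coe_mk, ← eval_pol]
    rfl
  · unfold VeroneseCode
    rw [Submodule.map_le_iff_le_comap]
    intro f hf
    rw [← f.support_sum_monomial_coeff]
    refine Submodule.sum_mem _ fun d hd => ?_
    have hd' : d.degree = 2 := by
      have := (mem_homogeneousSubmodule _ _).1 hf (mem_support_iff.1 hd)
      rw [Finsupp.degree_eq_weight_one]; exact this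
    rw [Finsupp.degree_eq_sum, Fin.sum_univ_three] at hd'
    rw [Submodule.mem_comap]
    have key : ∀ k : Fin 6, (∀ v : Fin 3 → F, v 0 ^ d 0 * v 1 ^ d 1 * v 2 ^ d 2 =
        qf (Pi.single k 1) v) → (LinearMap.pi fun p => (MvPolynomial.aeval (rep p)).toLinearMap)
          (monomial d (coeff d f)) ∈ LinearMap.range (Phi rep) := by
      intro k hk
      refine ⟨coeff d f • Pi.single k 1, ?_⟩
      ext p
      rw [map_smul]
      simp only [Phi, LinearMap.pi_apply, Pi.smul_apply, qL, LinearMap.coe_mk, AddHom.coe_mk,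
        AlgHom.toLinearMap_apply, aeval_monomial, ← hk]
      rw [Finsupp.prod_fintype _ _ (by simp), Fin.prod_univ_three]
      rfl
    have h0 : d 0 ≤ 2 := by omega
    have h1 : d 1 ≤ 2 := by omega
    have h2 : d 2 ≤ 2 := by omega
    by_cases c0 : d 0 = 2
    · exact key 0 fun v => by
        rw [c0, show d 1 = 0 by omega, show d 2 = 0 by omega]; simp [qf, pow_two]
    by_cases c1 : d 1 = 2
    · exact key 1 fun v => by
        rw [c1, show d 0 = 0 by omega, show d 2 = 0 by omega]; simp [qf, pow_two]
    by_cases c2 : d 2 = 2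
    · exact key 2 fun v => by
        rw [c2, show d 0 = 0 by omega, show d 1 = 0 by omega]; simp [qf, pow_two]
    by_cases c3 : d 2 = 0
    · exact key 3 fun v => by
        rw [c3, show d 0 = 1 by omega, show d 1 = 1 by omega]; simp [qf]
    by_cases c4 : d 1 = 0
    · exact key 4 fun v => by
        rw [c4, show d 0 = 1 by omega, show d 2 = 1 by omega]; simp [qf]
    · exact key 5 fun v => by
        rw [show d 0 = 0 by omega, show d 1 = 1 by omega, show d 2 = 1 by omega]; simp [qf]

/-- Being a section of the projectivization. -/
def IsSec (rep : Plane F → (Fin 3 → F)) : Prop :=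
  ∀ p : Plane F, ∃ h : rep p ≠ 0, Projectivization.mk F (rep p) h = p

lemma IsSec.ne {rep : Plane F → (Fin 3 → F)} (h : IsSec rep) {p p' : Plane F} (hp : p ≠ p')
    (c : F) : c • rep p ≠ rep p' := by
  intro e
  obtain ⟨h1, e1⟩ := h p
  obtain ⟨h2, e2⟩ := h p'
  apply hp
  rw [← e1, ← e2, eq_comm, Projectivization.mk_eq_mk_iff']
  exact ⟨c, e⟩

lemma IsSec.exists {rep : Plane F → (Fin 3 → F)} (h : IsSec rep) (v : Fin 3 → F) (hv : v ≠ 0) :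
    ∃ (p : Plane F) (c : Fˣ), c • rep p = v := by
  obtain ⟨h1, e1⟩ := h (Projectivization.mk F v hv)
  have := (Projectivization.mk_eq_mk_iff F _ _ hv h1).1 e1.symm
  obtain ⟨c, hc⟩ := this
  exact ⟨_, c, hc⟩

lemma cone [Fintype F] {rep : Plane F → (Fin 3 → F)} (h : IsSec rep) (P : (Fin 3 → F) → Prop)
    (h0 : ∀ v, P v → v ≠ 0) (hP : ∀ (c : Fˣ) v, P v → P (c • v)) :
    Nat.card {p | P (rep p)} * (Fintype.card F - 1) = Nat.card {v | P v} := by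
  classical
  rw [← Fintype.card_units, ← Nat.card_eq_fintype_card, ← Nat.card_prod]
  let f : {p | P (rep p)} × Fˣ → {v | P v} := fun x => ⟨x.2 • rep x.1.1, hP _ _ x.1.2⟩
  refine Nat.card_congr (Equiv.ofBijective f ⟨?_, ?_⟩)
  · rintro ⟨⟨p, hp⟩, c⟩ ⟨⟨p', hp'⟩, c'⟩ e
    have e' : c • rep p = c' • rep p' := congrArg Subtype.val e
    have hpp : p = p' := by
      by_contra hne
      refine h.ne hne (c'⁻¹ * c : Fˣ) ?_
      have : (c'⁻¹ * c) • rep p = rep p' := by rw [mul_smul, e', inv_smul_smul]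
      exact this
    subst hpp
    have : c = c' := by
      ext
      obtain ⟨hne, -⟩ := h p
      exact smul_left_injective F hne e'
    simp [this]
  · rintro ⟨v, hv⟩
    obtain ⟨p, c, e⟩ := h.exists v (h0 v hv)
    refine ⟨⟨⟨p, ?_⟩, c⟩, Subtype.ext e⟩
    have : P (c⁻¹ • v) := hP _ _ hv
    rwa [← e, inv_smul_smul] at this

/-- The weight of a space of coefficient vectors. -/
def wE (rep : Plane F → (Fin 3 → F)) (E : Submodule F (Fin 6 → F)) : ℕ :=
  Nat.card {p | ∃ a ∈ E, qf a (rep p) ≠ 0}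

lemma Phi_inj {rep : Plane F → (Fin 3 → F)} (h : IsSec rep) : Function.Injective (Phi rep) := by
  rw [injective_iff_map_eq_zero]
  intro a ha
  apply qf_eq_zero
  intro v
  by_cases hv : v = 0
  · simp [hv, qf]
  · obtain ⟨p, c, rfl⟩ := h.exists v hv
    have : qf a (rep p) = 0 := congrFun ha p
    rw [Units.smul_def, qf_smul, this, mul_zero]

lemma wtSub_map (rep : Plane F → (Fin 3 → F)) (E : Submodule F (Fin 6 → F)) :
    wtSub (E.map (Phi rep)) = wE rep E := by
  unfold wtSub wE
  have : {p | ∃ c ∈ E.map (Phi rep), c p ≠ 0} = {p | ∃ a ∈ E, qf a (rep p) ≠ 0} := by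
    ext p
    simp [Phi, qL]
  rw [this]

lemma ghw_eq {rep : Plane F → (Fin 3 → F)} (h : IsSec rep) (r w : ℕ)
    (hE : ∃ E : Submodule F (Fin 6 → F), Module.finrank F E = r ∧ wE rep E = w)
    (hl : ∀ E : Submodule F (Fin 6 → F), Module.finrank F E = r → w ≤ wE rep E) :
    ghw rep r = w := by
  unfold ghw
  apply le_antisymm
  · obtain ⟨E, h1, h2⟩ := hE
    apply Nat.sInf_le
    refine ⟨E.map (Phi rep), ?_, ?_, ?_⟩
    · rw [← range_Phi]; exact LinearMap.map_le_range
    · rw [← (Submodule.equivMapOfInjective _ (Phi_inj h) _).finrank_eq, h1]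
    · rw [wtSub_map, h2]
  · obtain ⟨E, h1, h2⟩ := hE
    refine le_csInf ⟨w, E.map (Phi rep), ?_, ?_, ?_⟩ ?_
    · rw [← range_Phi]; exact LinearMap.map_le_range
    · rw [← (Submodule.equivMapOfInjective _ (Phi_inj h) _).finrank_eq, h1]
    · rw [wtSub_map, h2]
    · rintro _ ⟨D, hD, hr, rfl⟩
      rw [← range_Phi] at hD
      obtain ⟨E', rfl⟩ : ∃ E', E'.map (Phi rep) = D :=
        ⟨D.comap (Phi rep), Submodule.map_comap_eq_of_le hD⟩
      rw [wtSub_map]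
      apply hl
      rw [← hr, ← (Submodule.equivMapOfInjective _ (Phi_inj h) _).finrank_eq]

section Lower

variable [Fintype F] {rep : Plane F → (Fin 3 → F)}

lemma card_plane (q : ℕ) (hq : Fintype.card F = q) : Nat.card (Plane F) = q ^ 2 + q + 1 := by
  rw [Projectivization.card_of_finrank F (Fin 3 → F) (n := 3) (by simp)]
  simp [Finset.sum_range_succ, hq]; ring

/-- Common zeros. -/
def ZE (rep : Plane F → (Fin 3 → F)) (E : Submodule F (Fin 6 → F)) : Set (Plane F) :=
  {p | ∀ a ∈ E, qf a (rep p) = 0}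

lemma wE_add (q : ℕ) (hq : Fintype.card F = q) (E : Submodule F (Fin 6 → F)) :
    wE rep E + (ZE rep E).ncard = q ^ 2 + q + 1 := by
  rw [← card_plane q hq]
  have : ZE rep E = {p | ∃ a ∈ E, qf a (rep p) ≠ 0}ᶜ := by
    ext p; simp [ZE]
  rw [this, wE]
  exact Set.ncard_add_ncard_compl _

lemma line_card (q : ℕ) (hq : Fintype.card F = q) (h : IsSec rep) (u v : Fin 3 → F) :
    ({p | ∃ s t : F, s • u + t • v = rep p} : Set (Plane F)).ncard ≤ q + 1 := by
  classical
  have hq2 : 1 < q := hq ▸ Fintype.one_lt_card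
  have key := cone h (fun x => x ≠ 0 ∧ ∃ s t : F, s • u + t • v = x) (fun _ hv => hv.1) (by
    rintro c _ ⟨h0, s, t, rfl⟩
    exact ⟨(smul_ne_zero_iff_ne c).2 h0, c * s, c * t, by
      rw [smul_add, Units.smul_def, Units.smul_def, smul_smul, smul_smul]⟩)
  have e : {p : Plane F | rep p ≠ 0 ∧ ∃ s t : F, s • u + t • v = rep p} =
      {p | ∃ s t : F, s • u + t • v = rep p} := by
    ext p; simp only [Set.mem_ofPred_eq, and_iff_right_iff_imp]; intro _; exact (h p).1
  rw [e] at key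
  have hb : Nat.card {x : Fin 3 → F | x ≠ 0 ∧ ∃ s t : F, s • u + t • v = x} + 1 ≤ q ^ 2 := by
    have h1 : Nat.card {x : Fin 3 → F | x ≠ 0 ∧ ∃ s t : F, s • u + t • v = x} ≤
        Nat.card {x : F × F // x ≠ 0} := by
      refine Nat.card_le_card_of_surjective
        (α := {x : F × F // x.1 • u + x.2 • v ≠ 0}) (fun x => ⟨_, x.2, _, _, rfl⟩) ?_ |>.trans ?_
      · rintro ⟨x, hx, s, t, rfl⟩
        exact ⟨⟨(s, t), hx⟩, rfl⟩
      · refine Nat.card_le_card_of_injective (fun x => ⟨x.1, ?_⟩) ?_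
        · intro h0; apply x.2; simp [h0]
        · intro x y hxy; exact Subtype.ext (congrArg Subtype.val hxy :)
    have h2 : Nat.card {x : F × F // x ≠ 0} = q ^ 2 - 1 := by
      simp [hq, pow_two]
    have : 0 < q ^ 2 := by positivity
    omega
  rw [hq] at key
  rw [← key] at hb
  obtain ⟨m, rfl⟩ : ∃ m, q = m + 1 := ⟨q - 1, by omega⟩
  simp only [Nat.add_sub_cancel] at hb
  change Nat.card _ ≤ _
  by_contra hc
  push Not at hc
  have : (m + 1 + 1 + 1) * m ≤ Nat.card {p : Plane F | ∃ s t : F, s • u + t • v = rep p} * m :=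
    Nat.mul_le_mul_right _ hc
  nlinarith

lemma low6 (h : IsSec rep) (E : Submodule F (Fin 6 → F)) (hE : Module.finrank F E = 6) :
    (ZE rep E).ncard ≤ 0 := by
  by_contra hc
  obtain ⟨p, hp⟩ : (ZE rep E).Nonempty := by
    rw [← Set.ncard_pos]; omega
  obtain ⟨v, hv⟩ := exists_second (rep p)
  obtain ⟨w, hw⟩ := exists_third (rep p) v
  have g := gen_of (h p).1 hv hw
  have := vrank_le E ![qL v, qL w, bL (rep p) v, bL (rep p) w, bL v w] (fun a ha H =>
    g.eq_zero (hp a ha) (H 0) (H 1) (H 2) (H 3) (H 4))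
  omega

lemma low5 (h : IsSec rep) (E : Submodule F (Fin 6 → F)) (hE : Module.finrank F E = 5) :
    (ZE rep E).ncard ≤ 1 := by
  by_contra hc
  push Not at hc
  obtain ⟨p, p', hp, hp', hne⟩ := (Set.one_lt_ncard_iff).1 hc
  obtain ⟨w, hw⟩ := exists_third (rep p) (rep p')
  have g := gen_of (h p).1 (h.ne hne) hw
  have := vrank_le E ![qL w, bL (rep p) (rep p'), bL (rep p) w, bL (rep p') w] (fun a ha H =>
    g.eq_zero (hp a ha) (hp' a ha) (H 0) (H 1) (H 2) (H 3))
  omega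

/-- A third collinear point forces the polar form to vanish. -/
lemma collinear (h : IsSec rep) (E : Submodule F (Fin 6 → F)) {p p' x : Plane F}
    (hp : p ∈ ZE rep E) (hp' : p' ∈ ZE rep E) (hx : x ∈ ZE rep E)
    (h1 : p ≠ x) (h2 : p' ≠ x) {s t : F} (e : s • rep p + t • rep p' = rep x) :
    ∀ a ∈ E, bf a (rep p) (rep p') = 0 := by
  intro a ha
  have hs : s ≠ 0 := by
    rintro rfl; exact h.ne h2 t (by simpa using e)
  have ht : t ≠ 0 := by
    rintro rfl; exact h.ne h1 s (by simpa using e)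
  have := hx a ha
  rw [← e, qf_comb2, hp a ha, hp' a ha] at this
  simpa [hs, ht] using this

lemma low4 (h : IsSec rep) (E : Submodule F (Fin 6 → F)) (hE : Module.finrank F E = 4) :
    (ZE rep E).ncard ≤ 2 := by
  by_contra hc
  push Not at hc
  obtain ⟨p, p', x, hp, hp', hx, h1, h2, h3⟩ := (Set.two_lt_ncard_iff).1 hc
  by_cases hcol : ∃ s t : F, s • rep p + t • rep p' = rep x
  · obtain ⟨s, t, e⟩ := hcol
    have hb := collinear h E hp hp' hx h2 h3 e
    obtain ⟨w, hw⟩ := exists_third (rep p) (rep p')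
    have g := gen_of (h p).1 (h.ne h1) hw
    have := vrank_le E ![qL w, bL (rep p) w, bL (rep p') w] (fun a ha H =>
      g.eq_zero (hp a ha) (hp' a ha) (H 0) (hb a ha) (H 1) (H 2))
    omega
  · push Not at hcol
    have g := gen_of (h p).1 (h.ne h1) hcol
    have := vrank_le E ![bL (rep p) (rep p'), bL (rep p) (rep x), bL (rep p') (rep x)]
      (fun a ha H => g.eq_zero (hp a ha) (hp' a ha) (hx a ha) (H 0) (H 1) (H 2))
    omega

lemma exists_new {Z : Set (Plane F)} (A : Set (Plane F)) (hA : A.ncard < Z.ncard) :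
    ∃ x ∈ Z, x ∉ A := Set.exists_mem_notMem_of_ncard_lt_ncard hA

lemma ncard_triple (p p' w : Plane F) : ({p, p', w} : Set (Plane F)).ncard ≤ 3 := by
  have h1 := Set.ncard_insert_le p {p', w}
  have h2 := Set.ncard_insert_le p' {w}
  have h3 := Set.ncard_singleton w
  omega

lemma low3 (q : ℕ) (hq : Fintype.card F = q) (hq4 : 4 ≤ q)
    (h : IsSec rep) (E : Submodule F (Fin 6 → F)) (hE : Module.finrank F E = 3) :
    (ZE rep E).ncard ≤ q + 1 := by
  by_contra hc
  push Not at hc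
  obtain ⟨p, p', hp, hp', h1⟩ := (Set.one_lt_ncard_iff).1 (show 1 < (ZE rep E).ncard by omega)
  obtain ⟨w, hw, hwl⟩ := exists_new {x | ∃ s t : F, s • rep p + t • rep p' = rep x}
    ((line_card q hq h (rep p) (rep p')).trans_lt hc)
  simp only [Set.mem_ofPred_eq, not_exists] at hwl
  have g := gen_of (h p).1 (h.ne h1) hwl
  obtain ⟨x, hx, hxn⟩ := exists_new (Z := ZE rep E) {p, p', w} (by
    have := ncard_triple p p' w; omega)
  simp only [Set.mem_insert_iff, Set.mem_singleton_iff, not_or] at hxn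
  obtain ⟨s, t, r, e⟩ := g (rep x)
  have n1 : ¬ (t = 0 ∧ r = 0) := by
    rintro ⟨rfl, rfl⟩; exact h.ne (Ne.symm hxn.1) s (by simpa using e.symm)
  have n2 : ¬ (s = 0 ∧ r = 0) := by
    rintro ⟨rfl, rfl⟩; exact h.ne (Ne.symm hxn.2.1) t (by simpa using e.symm)
  have n3 : ¬ (s = 0 ∧ t = 0) := by
    rintro ⟨rfl, rfl⟩; exact h.ne (Ne.symm hxn.2.2) r (by simpa using e.symm)
  have rel : ∀ a ∈ E, s * t * bf a (rep p) (rep p') + s * r * bf a (rep p) (rep w) +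
      t * r * bf a (rep p') (rep w) = 0 := by
    intro a ha
    have := hx a ha
    rw [e, qf_comb, hp a ha, hp' a ha, hw a ha] at this
    simpa using this
  by_cases hs : s = 0
  · have ht : t ≠ 0 := fun ht => n3 ⟨hs, ht⟩
    have hr : r ≠ 0 := fun hr => n2 ⟨hs, hr⟩
    have := vrank_le E ![bL (rep p) (rep p'), bL (rep p) (rep w)] (fun a ha H =>
      g.eq_zero (hp a ha) (hp' a ha) (hw a ha) (H 0) (H 1) (by
        simpa [hs, ht, hr] using rel a ha))
    omega
  by_cases ht : t = 0
  · have hr : r ≠ 0 := fun hr => n1 ⟨ht, hr⟩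
    have := vrank_le E ![bL (rep p) (rep p'), bL (rep p') (rep w)] (fun a ha H =>
      g.eq_zero (hp a ha) (hp' a ha) (hw a ha) (H 0) (by
        simpa [hs, ht, hr] using rel a ha) (H 1))
    omega
  · have := vrank_le E ![bL (rep p) (rep w), bL (rep p') (rep w)] (fun a ha H => by
      have h0 : bf a (rep p) (rep w) = 0 := H 0
      have h1 : bf a (rep p') (rep w) = 0 := H 1
      exact g.eq_zero (hp a ha) (hp' a ha) (hw a ha) (by
        simpa [hs, ht, h0, h1] using rel a ha) h0 h1)
    omega

lemma low2 (q : ℕ) (hq : Fintype.card F = q) (hq4 : 4 ≤ q)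
    (h : IsSec rep) (E : Submodule F (Fin 6 → F)) (hE : Module.finrank F E = 2) :
    (ZE rep E).ncard ≤ q + 2 := by
  by_contra hc
  push Not at hc
  by_cases hcol : ∃ p ∈ ZE rep E, ∃ p' ∈ ZE rep E, ∃ x ∈ ZE rep E, p ≠ p' ∧ p ≠ x ∧ p' ≠ x ∧
      ∃ s t : F, s • rep p + t • rep p' = rep x
  · obtain ⟨p, hp, p', hp', x, hx, h1, h2, h3, s, t, e⟩ := hcol
    have hb := collinear h E hp hp' hx h2 h3 e
    have hl := line_card q hq h (rep p) (rep p')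
    obtain ⟨w, hw, hwl⟩ := exists_new (Z := ZE rep E)
      {x | ∃ s t : F, s • rep p + t • rep p' = rep x} (by omega)
    obtain ⟨y, hy, hyl⟩ := exists_new (Z := ZE rep E)
      (insert w {x | ∃ s t : F, s • rep p + t • rep p' = rep x}) (by
        have := Set.ncard_insert_le w {x | ∃ s t : F, s • rep p + t • rep p' = rep x}
        omega)
    simp only [Set.mem_ofPred_eq, not_exists, Set.mem_insert_iff, not_or] at hwl hyl
    have g := gen_of (h p).1 (h.ne h1) hwl
    obtain ⟨s, t, r, e⟩ := g (rep y)
    have hr : r ≠ 0 := by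
      rintro rfl; exact hyl.2 s t (by simpa using e.symm)
    have n : ¬ (s = 0 ∧ t = 0) := by
      rintro ⟨rfl, rfl⟩; exact h.ne (Ne.symm hyl.1) r (by simpa using e.symm)
    have rel : ∀ a ∈ E, s * bf a (rep p) (rep w) + t * bf a (rep p') (rep w) = 0 := by
      intro a ha
      have := hy a ha
      rw [e, qf_comb, hp a ha, hp' a ha, hw a ha, hb a ha] at this
      have : r * (s * bf a (rep p) (rep w) + t * bf a (rep p') (rep w)) = 0 := by
        linear_combination this
      simpa [hr] using this
    by_cases hs : s = 0
    · have ht : t ≠ 0 := fun ht => n ⟨hs, ht⟩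
      have := vrank_le E ![bL (rep p) (rep w)] (fun a ha H =>
        g.eq_zero (hp a ha) (hp' a ha) (hw a ha) (hb a ha) (H 0) (by
          simpa [hs, ht] using rel a ha))
      omega
    · have := vrank_le E ![bL (rep p') (rep w)] (fun a ha H => by
        have h0 : bf a (rep p') (rep w) = 0 := H 0
        exact g.eq_zero (hp a ha) (hp' a ha) (hw a ha) (hb a ha) (by
          simpa [hs, h0] using rel a ha) h0)
      omega
  · have nc : ∀ p ∈ ZE rep E, ∀ p' ∈ ZE rep E, ∀ x ∈ ZE rep E, p ≠ p' → p ≠ x → p' ≠ x →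
      ∀ s t : F, s • rep p + t • rep p' ≠ rep x := by
      intro p hp p' hp' x hx h1 h2 h3 s t e
      exact hcol ⟨p, hp, p', hp', x, hx, h1, h2, h3, s, t, e⟩
    obtain ⟨p, p', w, hp, hp', hw, h1, h2, h3⟩ :=
      (Set.two_lt_ncard_iff).1 (show 2 < (ZE rep E).ncard by omega)
    have g := gen_of (h p).1 (h.ne h1) (nc p hp p' hp' w hw h1 h2 h3)
    obtain ⟨x, hx, hxn⟩ := exists_new (Z := ZE rep E) {p, p', w} (by
      have := ncard_triple p p' w; omega)
    obtain ⟨y, hy, hyn⟩ := exists_new (Z := ZE rep E) {x, p, p', w} (by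
      have := ncard_triple p p' w
      have := Set.ncard_insert_le x {p, p', w}; omega)
    simp only [Set.mem_insert_iff, Set.mem_singleton_iff, not_or] at hxn hyn
    have coords : ∀ x ∈ ZE rep E, x ≠ p → x ≠ p' → x ≠ w → ∃ s t r : F, s ≠ 0 ∧ t ≠ 0 ∧ r ≠ 0 ∧
        rep x = s • rep p + t • rep p' + r • rep w ∧
        ∀ a ∈ E, s * t * bf a (rep p) (rep p') + s * r * bf a (rep p) (rep w) +
          t * r * bf a (rep p') (rep w) = 0 := by
      intro x hx m1 m2 m3
      obtain ⟨s, t, r, e⟩ := g (rep x)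
      refine ⟨s, t, r, ?_, ?_, ?_, e, ?_⟩
      · rintro rfl
        exact nc p' hp' w hw x hx h3 m2.symm m3.symm t r (by simpa using e.symm)
      · rintro rfl
        exact nc p hp w hw x hx h2 m1.symm m3.symm s r (by simpa using e.symm)
      · rintro rfl
        exact nc p hp p' hp' x hx h1 m1.symm m2.symm s t (by simpa using e.symm)
      · intro a ha
        have := hx a ha
        rw [e, qf_comb, hp a ha, hp' a ha, hw a ha] at this
        simpa using this
    obtain ⟨s, t, r, hs, ht, hr, e, rel⟩ := coords x hx hxn.1 hxn.2.1 hxn.2.2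
    obtain ⟨s', t', r', hs', ht', hr', e', rel'⟩ := coords y hy hyn.2.1 hyn.2.2.1 hyn.2.2.2
    by_cases d1 : t * r' - t' * r = 0
    · have d2 : s * r' - s' * r ≠ 0 := by
        intro d2
        apply h.ne (Ne.symm hyn.1) (r' / r)
        rw [e, e', smul_add, smul_add, smul_smul, smul_smul, smul_smul]
        congr 2
        · congr 1; congr 1; field_simp; linear_combination d2
        · congr 1; field_simp; linear_combination d1
        · congr 1; field_simp
      have := vrank_le E ![bL (rep p) (rep w)] (fun a ha H => by
        have h0 : bf a (rep p) (rep w) = 0 := H 0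
        have r1 := rel a ha
        have r2 := rel' a ha
        rw [h0] at r1 r2
        have r1' : s * bf a (rep p) (rep p') + r * bf a (rep p') (rep w) = 0 := by
          apply mul_left_cancel₀ ht; linear_combination r1
        have r2' : s' * bf a (rep p) (rep p') + r' * bf a (rep p') (rep w) = 0 := by
          apply mul_left_cancel₀ ht'; linear_combination r2
        have z1 : bf a (rep p) (rep p') = 0 := by
          apply mul_left_cancel₀ d2; linear_combination r' * r1' - r * r2'
        have z2 : bf a (rep p') (rep w) = 0 := by
          apply mul_left_cancel₀ d2; linear_combination s * r2' - s' * r1'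
        exact g.eq_zero (hp a ha) (hp' a ha) (hw a ha) z1 h0 z2)
      omega
    · have := vrank_le E ![bL (rep p') (rep w)] (fun a ha H => by
        have h0 : bf a (rep p') (rep w) = 0 := H 0
        have r1 := rel a ha
        have r2 := rel' a ha
        rw [h0] at r1 r2
        have r1' : t * bf a (rep p) (rep p') + r * bf a (rep p) (rep w) = 0 := by
          apply mul_left_cancel₀ hs; linear_combination r1
        have r2' : t' * bf a (rep p) (rep p') + r' * bf a (rep p) (rep w) = 0 := by
          apply mul_left_cancel₀ hs'; linear_combination r2
        have z1 : bf a (rep p) (rep p') = 0 := by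
          apply mul_left_cancel₀ d1; linear_combination r' * r1' - r * r2'
        have z2 : bf a (rep p) (rep w) = 0 := by
          apply mul_left_cancel₀ d1; linear_combination t * r2' - t' * r1'
        exact g.eq_zero (hp a ha) (hp' a ha) (hw a ha) z1 z2 h0)
      omega

lemma card_nonzero (q : ℕ) (hq : Fintype.card F = q) (a : Fin 6 → F) (ha : a ≠ 0) :
    ∃ M, Nat.card {v | qf a v ≠ 0} = M ∧ q ^ 3 ≤ M + 2 * q ^ 2 ∧ ringChar F ∣ M := by
  classical
  have hq2 : 1 < q := hq ▸ Fintype.one_lt_card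
  have hpol : pol a ≠ 0 := by
    intro h0
    apply ha
    apply qf_eq_zero
    intro v
    rw [← eval_pol, h0, map_zero]
  have hdeg : (pol a).totalDegree = 2 := (pol_hom a).totalDegree hpol
  have hsum : Nat.card {v | qf a v ≠ 0} + Nat.card {v // qf a v = 0} = q ^ 3 := by
    have := Set.ncard_add_ncard_compl {v | qf a v ≠ 0}
    have e : {v | qf a v ≠ 0}ᶜ = {v | qf a v = 0} := by ext; simp
    rw [e] at this
    have e2 : Nat.card (Fin 3 → F) = q ^ 3 := by simp [hq]
    rw [← e2]
    exact this
  have hN : Nat.card {v // qf a v = 0} ≤ 2 * q ^ 2 := by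
    have := schwartz_zippel_totalDegree hpol (Finset.univ : Finset F)
    rw [hdeg] at this
    simp only [Fintype.piFinset_univ, eval_pol, Finset.card_univ, hq] at this
    rw [← Fintype.card_subtype, ← Nat.card_eq_fintype_card] at this
    have hq0 : (0 : ℚ≥0) < q := by exact_mod_cast (by omega : 0 < q)
    rw [div_le_div_iff₀ (by positivity) hq0] at this
    have h2 : Nat.card {v // qf a v = 0} * q ≤ 2 * q ^ 3 := by exact_mod_cast this
    have : Nat.card {v // qf a v = 0} * q ≤ 2 * q ^ 2 * q := by
      rw [mul_assoc, ← pow_succ]; exact h2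
    exact Nat.le_of_mul_le_mul_right this (by omega)
  have hd : ringChar F ∣ Nat.card {v // qf a v = 0} := by
    have := char_dvd_card_solutions (ringChar F) (f := pol a) (by rw [hdeg]; simp)
    simp only [eval_pol] at this
    rwa [Nat.card_eq_fintype_card]
  refine ⟨_, rfl, by omega, ?_⟩
  have hqd : ringChar F ∣ q ^ 3 := by
    apply dvd_pow _ (by norm_num)
    rw [← hq, ← CharP.cast_eq_zero_iff F]
    simp
  rw [← hsum] at hqd
  exact (Nat.dvd_add_left hd).1 hqd

lemma low1 (q : ℕ) (hq : Fintype.card F = q) (hq4 : 4 ≤ q)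
    (h : IsSec rep) (E : Submodule F (Fin 6 → F)) (hE : Module.finrank F E = 1) :
    q ^ 2 - q ≤ wE rep E := by
  obtain ⟨a, haE, ha⟩ : ∃ a ∈ E, a ≠ 0 := by
    apply Submodule.exists_mem_ne_zero_of_ne_bot
    rintro rfl
    simp at hE
  obtain ⟨M, hM, hM1, hM2⟩ := card_nonzero q hq a ha
  have hc := cone h (fun v => qf a v ≠ 0) (by rintro v hv rfl; simp [qf] at hv) (by
    intro c v hv
    rw [Units.smul_def, qf_smul]
    exact mul_ne_zero (pow_ne_zero _ c.ne_zero) hv)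
  have hle : Nat.card {p | qf a (rep p) ≠ 0} ≤ wE rep E :=
    Set.ncard_le_ncard (fun p hp => ⟨a, haE, hp⟩)
  refine le_trans ?_ hle
  rw [hM, hq] at hc
  generalize Nat.card {p | qf a (rep p) ≠ 0} = n at hc
  have hpq : ringChar F ∣ q := by
    rw [← hq, ← CharP.cast_eq_zero_iff F]
    simp
  obtain ⟨m, rfl⟩ : ∃ m, q = m + 1 := ⟨q - 1, by omega⟩
  simp only [Nat.add_sub_cancel] at hc
  have e : (m + 1) ^ 2 - (m + 1) = m * m + m := by
    have : (m + 1) ^ 2 = m * m + m + (m + 1) := by ring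
    omega
  rw [e]
  have hge : m * m + m ≤ n + 1 := by
    by_contra hcon
    have : n + 2 ≤ m * m + m := by omega
    have : (n + 2) * m ≤ (m * m + m) * m := Nat.mul_le_mul_right _ this
    nlinarith
  by_contra hcon
  have hn : n + 1 = m * m + m := by omega
  have hM3 : M + m = (m + 1) * (m * m) := by
    rw [← hc]; linear_combination m * hn
  have hm : ringChar F ∣ m := by
    have : ringChar F ∣ M + m := hM3 ▸ hpq.mul_right _
    exact (Nat.dvd_add_right hM2).1 this
  have h1 : ringChar F ∣ 1 := (Nat.dvd_add_right hm).1 hpq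
  exact CharP.ringChar_ne_one (Nat.dvd_one.1 h1)

end Lower

section Upper

variable [Fintype F] {rep : Plane F → (Fin 3 → F)}

lemma ex_aux (q : ℕ) (hq : Fintype.card F = q) (hq4 : 4 ≤ q) (h : IsSec rep) {r : ℕ}
    (g : Fin r → Fin 6) (hg : Function.Injective g) (w : ℕ)
    (hw : Nat.card {v : Fin 3 → F | ∃ i, qf (Pi.single (g i) 1) v ≠ 0} = w * (q - 1)) :
    ∃ E : Submodule F (Fin 6 → F), Module.finrank F E = r ∧ wE rep E = w := by
  classical
  refine ⟨Submodule.span F (Set.range fun i => Pi.single (g i) 1), ?_, ?_⟩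
  · have hli : LinearIndependent F (fun i => (Pi.single (g i) 1 : Fin 6 → F)) := by
      have := (Pi.basisFun F (Fin 6)).linearIndependent.comp g hg
      convert this using 2
      simp
    rw [finrank_span_eq_card hli, Fintype.card_fin]
  · have hc := cone h (fun v => ∃ i, qf (Pi.single (g i) 1) v ≠ 0)
      (by rintro v ⟨i, hv⟩ rfl; simp [qf] at hv) (by
        rintro c v ⟨i, hv⟩
        refine ⟨i, ?_⟩
        rw [Units.smul_def, qf_smul]
        exact mul_ne_zero (pow_ne_zero _ c.ne_zero) hv)
    rw [hw, hq] at hc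
    have e : {p | ∃ a ∈ Submodule.span F (Set.range fun i => (Pi.single (g i) 1 : Fin 6 → F)),
        qf a (rep p) ≠ 0} = {p | ∃ i, qf (Pi.single (g i) 1) (rep p) ≠ 0} := by
      ext p
      constructor
      · rintro ⟨a, ha, hne⟩
        by_contra hcon
        have hcon' : ∀ i, qf (Pi.single (g i) 1) (rep p) = 0 := by
          intro i; by_contra hi; exact hcon ⟨i, hi⟩
        have hle : Submodule.span F (Set.range fun i => (Pi.single (g i) 1 : Fin 6 → F)) ≤
            LinearMap.ker (qL (rep p)) := by
          rw [Submodule.span_le]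
          rintro _ ⟨i, rfl⟩
          exact hcon' i
        exact hne (hle ha)
      · rintro ⟨i, hi⟩
        exact ⟨_, Submodule.subset_span ⟨i, rfl⟩, hi⟩
    rw [wE, e]
    exact Nat.eq_of_mul_eq_mul_right (by omega) hc

lemma box (A B C : Finset F) : Nat.card {v : Fin 3 → F | v 0 ∈ A ∧ v 1 ∈ B ∧ v 2 ∈ C} =
    A.card * B.card * C.card := by
  classical
  have : {v : Fin 3 → F | v 0 ∈ A ∧ v 1 ∈ B ∧ v 2 ∈ C} =
      (Fintype.piFinset ![A, B, C] : Set (Fin 3 → F)) := by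
    ext v
    simp [Fin.forall_fin_succ]
  rw [this]
  change Set.ncard _ = _
  rw [Set.ncard_coe_finset, Fintype.card_piFinset, Fin.prod_univ_three]
  rfl

lemma card_split (P Q : (Fin 3 → F) → Prop) :
    Nat.card {v | P v} = Nat.card {v | P v ∧ Q v} + Nat.card {v | P v ∧ ¬ Q v} := by
  exact (Set.ncard_inter_add_ncard_sdiff_eq_ncard {v | P v} {v | Q v} (Set.toFinite _)).symm

/-- The nonzero elements. -/
def nz (F : Type*) [Field F] [Fintype F] : Finset F := by
  classical exact Finset.univ.erase 0

lemma mem_nz (x : F) : x ∈ nz F ↔ x ≠ 0 := by classical simp [nz]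

lemma card_nz : (nz F).card = Fintype.card F - 1 := by
  classical simp [nz]

lemma box_nnu (q : ℕ) (hq : Fintype.card F = q) :
    Nat.card {v : Fin 3 → F | v 0 ≠ 0 ∧ v 1 ≠ 0} = (q - 1) * (q - 1) * q := by
  have := box (nz F) (nz F) Finset.univ
  simpa [mem_nz, card_nz, hq] using this

lemma box_nuu (q : ℕ) (hq : Fintype.card F = q) :
    Nat.card {v : Fin 3 → F | v 0 ≠ 0} = (q - 1) * q * q := by
  have := box (nz F) Finset.univ Finset.univ
  simpa [mem_nz, card_nz, hq] using this

lemma box_nzz (q : ℕ) (hq : Fintype.card F = q) :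
    Nat.card {v : Fin 3 → F | v 0 ≠ 0 ∧ v 1 = 0 ∧ v 2 = 0} = q - 1 := by
  have := box (nz F) {0} {0}
  simpa [mem_nz, card_nz, hq] using this

lemma box_zuz (q : ℕ) (hq : Fintype.card F = q) :
    Nat.card {v : Fin 3 → F | v 0 = 0 ∧ v 2 = 0} = q := by
  have := box {0} (Finset.univ : Finset F) {0}
  simpa [hq] using this

lemma box_uzz (q : ℕ) (hq : Fintype.card F = q) :
    Nat.card {v : Fin 3 → F | v 1 = 0 ∧ v 2 = 0} = q := by
  have := box (Finset.univ : Finset F) {0} {0}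
  simpa [hq] using this

lemma box_zzz : Nat.card {v : Fin 3 → F | v 0 = 0 ∧ v 1 = 0 ∧ v 2 = 0} = 1 := by
  have := box ({0} : Finset F) {0} {0}
  simpa using this

lemma card_compl' (q : ℕ) (hq : Fintype.card F = q) (P : (Fin 3 → F) → Prop) :
    q ^ 3 = Nat.card {v | P v} + Nat.card {v | ¬ P v} := by
  have e2 : Nat.card (Fin 3 → F) = q ^ 3 := by simp [hq]
  rw [← e2]
  exact (Set.ncard_add_ncard_compl {v | P v}).symm

lemma set_congr {P Q : (Fin 3 → F) → Prop} (h : ∀ v, P v ↔ Q v) :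
    Nat.card {v | P v} = Nat.card {v | Q v} := by
  rw [funext fun v => propext (h v)]

lemma ex1 (q : ℕ) (hq : Fintype.card F = q) (hq4 : 4 ≤ q) (h : IsSec rep) :
    ∃ E : Submodule F (Fin 6 → F), Module.finrank F E = 1 ∧ wE rep E = q ^ 2 - q := by
  refine ex_aux q hq hq4 h ![3] (by decide) _ ?_
  rw [set_congr (Q := fun v => v 0 ≠ 0 ∧ v 1 ≠ 0), box_nnu q hq]
  · obtain ⟨m, rfl⟩ : ∃ m, q = m + 1 := ⟨q - 1, by omega⟩
    have e : (m + 1) ^ 2 - (m + 1) = m * m + m := by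
      have : (m + 1) ^ 2 = m * m + m + (m + 1) := by ring
      omega
    rw [e]; simp only [Nat.add_sub_cancel]; ring
  · intro v; simp [qf]

lemma ex2 (q : ℕ) (hq : Fintype.card F = q) (hq4 : 4 ≤ q) (h : IsSec rep) :
    ∃ E : Submodule F (Fin 6 → F), Module.finrank F E = 2 ∧ wE rep E = q ^ 2 - 1 := by
  refine ex_aux q hq hq4 h ![3, 4] (by decide) _ ?_
  rw [set_congr (Q := fun v => v 0 ≠ 0 ∧ ¬ (v 1 = 0 ∧ v 2 = 0))]
  · have h1 := card_split (F := F) (fun v => v 0 ≠ 0) (fun v => v 1 = 0 ∧ v 2 = 0)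
    rw [box_nuu q hq, box_nzz q hq] at h1
    obtain ⟨m, rfl⟩ : ∃ m, q = m + 1 := ⟨q - 1, by omega⟩
    have e : (m + 1) ^ 2 - 1 = m * m + 2 * m := by
      have : (m + 1) ^ 2 = m * m + 2 * m + 1 := by ring
      omega
    rw [e]; simp only [Nat.add_sub_cancel] at h1 ⊢
    linarith
  · intro v; simp [qf, Fin.exists_fin_succ]; tauto

lemma ex3 (q : ℕ) (hq : Fintype.card F = q) (hq4 : 4 ≤ q) (h : IsSec rep) :
    ∃ E : Submodule F (Fin 6 → F), Module.finrank F E = 3 ∧ wE rep E = q ^ 2 := by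
  refine ex_aux q hq hq4 h ![0, 3, 4] (by decide) _ ?_
  rw [set_congr (Q := fun v => v 0 ≠ 0), box_nuu q hq]
  · ring
  · intro v; simp [qf, Fin.exists_fin_succ]; tauto

lemma ex4 (q : ℕ) (hq : Fintype.card F = q) (hq4 : 4 ≤ q) (h : IsSec rep) :
    ∃ E : Submodule F (Fin 6 → F), Module.finrank F E = 4 ∧ wE rep E = q ^ 2 + q - 1 := by
  refine ex_aux q hq hq4 h ![2, 3, 4, 5] (by decide) _ ?_
  rw [set_congr (Q := fun v => ¬ ((v 0 = 0 ∨ v 1 = 0) ∧ v 2 = 0))]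
  · have h1 := card_compl' q hq (fun v => (v 0 = 0 ∨ v 1 = 0) ∧ v 2 = 0)
    rw [card_split (F := F) (fun v => (v 0 = 0 ∨ v 1 = 0) ∧ v 2 = 0) (fun v => v 0 = 0),
      set_congr (P := fun v => ((v 0 = 0 ∨ v 1 = 0) ∧ v 2 = 0) ∧ v 0 = 0)
        (Q := fun v => v 0 = 0 ∧ v 2 = 0) (by intro v; tauto),
      set_congr (P := fun v => ((v 0 = 0 ∨ v 1 = 0) ∧ v 2 = 0) ∧ ¬ v 0 = 0)
        (Q := fun v => v 0 ≠ 0 ∧ v 1 = 0 ∧ v 2 = 0) (by intro v; tauto),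
      box_zuz q hq, box_nzz q hq] at h1
    obtain ⟨m, rfl⟩ : ∃ m, q = m + 1 := ⟨q - 1, by omega⟩
    have e : (m + 1) ^ 2 + (m + 1) - 1 = m * m + 3 * m + 1 := by
      have : (m + 1) ^ 2 = m * m + 2 * m + 1 := by ring
      omega
    rw [e]; simp only [Nat.add_sub_cancel] at h1 ⊢
    linarith
  · intro v; simp [qf, Fin.exists_fin_succ]; tauto

lemma ex5 (q : ℕ) (hq : Fintype.card F = q) (hq4 : 4 ≤ q) (h : IsSec rep) :
    ∃ E : Submodule F (Fin 6 → F), Module.finrank F E = 5 ∧ wE rep E = q ^ 2 + q := by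
  refine ex_aux q hq hq4 h ![1, 2, 3, 4, 5] (by decide) _ ?_
  rw [set_congr (Q := fun v => ¬ (v 1 = 0 ∧ v 2 = 0))]
  · have h1 := card_compl' q hq (fun v => v 1 = 0 ∧ v 2 = 0)
    rw [box_uzz q hq] at h1
    obtain ⟨m, rfl⟩ : ∃ m, q = m + 1 := ⟨q - 1, by omega⟩
    simp only [Nat.add_sub_cancel] at h1 ⊢
    linarith
  · intro v; simp [qf, Fin.exists_fin_succ]; tauto

lemma ex6 (q : ℕ) (hq : Fintype.card F = q) (hq4 : 4 ≤ q) (h : IsSec rep) :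
    ∃ E : Submodule F (Fin 6 → F), Module.finrank F E = 6 ∧ wE rep E = q ^ 2 + q + 1 := by
  refine ex_aux q hq hq4 h ![0, 1, 2, 3, 4, 5] (by decide) _ ?_
  rw [set_congr (Q := fun v => ¬ (v 0 = 0 ∧ v 1 = 0 ∧ v 2 = 0))]
  · have h1 := card_compl' q hq (fun v => v 0 = 0 ∧ v 1 = 0 ∧ v 2 = 0)
    rw [box_zzz] at h1
    obtain ⟨m, rfl⟩ : ∃ m, q = m + 1 := ⟨q - 1, by omega⟩
    simp only [Nat.add_sub_cancel] at h1 ⊢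
    linarith
  · intro v; simp [qf, Fin.exists_fin_succ]; tauto

end Upper

end Helpers

theorem veronese_generalized_hamming_weights
    {F : Type*} [Field F] [Fintype F] (q : ℕ) (hq : Fintype.card F = q) (hq4 : 4 ≤ q)
    (rep : Plane F → (Fin 3 → F))
    (hrep : ∀ p : Plane F, ∃ h : rep p ≠ 0, Projectivization.mk F (rep p) h = p) :
    ghw rep 1 = q ^ 2 - q ∧
    ghw rep 2 = q ^ 2 - 1 ∧
    ghw rep 3 = q ^ 2 ∧
    ghw rep 4 = q ^ 2 + q - 1 ∧
    ghw rep 5 = q ^ 2 + q ∧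
    ghw rep 6 = q ^ 2 + q + 1 := by
  have h : IsSec rep := hrep
  have hqq : q ≤ q ^ 2 := by nlinarith
  refine ⟨?_, ?_, ?_, ?_, ?_, ?_⟩
  · exact ghw_eq h 1 _ (ex1 q hq hq4 h) (low1 q hq hq4 h)
  · refine ghw_eq h 2 _ (ex2 q hq hq4 h) fun E hE => ?_
    have := low2 q hq hq4 h E hE
    have := wE_add (rep := rep) q hq E
    omega
  · refine ghw_eq h 3 _ (ex3 q hq hq4 h) fun E hE => ?_
    have := low3 q hq hq4 h E hE
    have := wE_add (rep := rep) q hq E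
    omega
  · refine ghw_eq h 4 _ (ex4 q hq hq4 h) fun E hE => ?_
    have := low4 h E hE
    have := wE_add (rep := rep) q hq E
    omega
  · refine ghw_eq h 5 _ (ex5 q hq hq4 h) fun E hE => ?_
    have := low5 h E hE
    have := wE_add (rep := rep) q hq E
    omega
  · refine ghw_eq h 6 _ (ex6 q hq hq4 h) fun E hE => ?_
    have := low6 h E hE
    have := wE_add (rep := rep) q hq E
    omega
end
end

section
/- Let q ≥ 4 be a prime power. For the Veronese code C_q, the number of 2-dimensional subcodes of each weight is: A_{q^2−1}^(2) = q^4+q^3+q^2, A_{q^2}^(2) = q^3+2q^2+2q+1, A_{q^2+q−3}^(2) = (q^8−q^6−q^5+q^3)/24, A_{q^2+q−2}^(2) = (q^7+q^6−q^4−q^3)/2, A_{q^2+q−1}^(2) = (q^8+5q^6+7q^5+4q^4−q^3−4q^2)/4, A_{q^2+q}^(2) = (2q^8+3q^7+q^6+4q^5+9q^4+5q^3−6q)/6, A_{q^2+q+1}^(2) = (3q^8+q^6−3q^5−q^3)/8, and A_w^(2) = 0 for every other weight w. -/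
noncomputable section

open MvPolynomial

section VG
open Finset

/-- The words of `C` vanishing on `S`. -/
def VK {F P : Type*} [Field F] (C : Submodule F (P → F)) (S : Finset P) : Submodule F (P → F) where
  carrier := {c | c ∈ C ∧ ∀ p ∈ S, c p = 0}
  add_mem' := by
    rintro a b ⟨ha, ha'⟩ ⟨hb, hb'⟩
    exact ⟨C.add_mem ha hb, fun p hp => by simp [ha' p hp, hb' p hp]⟩
  zero_mem' := ⟨C.zero_mem, fun p _ => rfl⟩
  smul_mem' := by
    rintro r a ⟨ha, ha'⟩
    exact ⟨C.smul_mem r ha, fun p hp => by simp [ha' p hp]⟩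

lemma mem_VK {F P : Type*} [Field F] {C : Submodule F (P → F)} {S : Finset P} {c : P → F} :
    c ∈ VK C S ↔ c ∈ C ∧ ∀ p ∈ S, c p = 0 := Iff.rfl

lemma VK_rank {F P : Type*} [Field F] [Finite P] (C : Submodule F (P → F)) (S : Finset P)
    (h : ∀ p ∈ S, ∃ c ∈ C, c p ≠ 0 ∧ ∀ p' ∈ S, p' ≠ p → c p' = 0) :
    Module.finrank F (VK C S) + #S = Module.finrank F C := by
  classical
  let φ : C →ₗ[F] (S → F) := (LinearMap.funLeft F F (Subtype.val : S → P)) ∘ₗ C.subtype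
  have hφ : ∀ c : C, ∀ s : S, φ c s = (c : P → F) s := fun c s => rfl
  have hr : LinearMap.range φ = ⊤ := by
    rw [eq_top_iff, ← (Pi.basisFun F S).span_eq, Submodule.span_le]
    rintro _ ⟨s, rfl⟩
    obtain ⟨c, hc, h1, h2⟩ := h s s.2
    refine ⟨⟨(c s)⁻¹ • c, C.smul_mem _ hc⟩, ?_⟩
    ext t
    rw [hφ]
    by_cases hts : t = s
    · subst hts; simp [h1]
    · have := h2 t t.2 (fun e => hts (Subtype.ext e))
      simp [this, hts]
  have hk : (LinearMap.ker φ).map C.subtype = VK C S := by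
    ext c
    simp only [Submodule.mem_map, LinearMap.mem_ker, mem_VK]
    constructor
    · rintro ⟨d, hd, rfl⟩
      exact ⟨d.2, fun p hp => by simpa [hφ] using congrFun hd ⟨p, hp⟩⟩
    · rintro ⟨h1, h2⟩
      exact ⟨⟨c, h1⟩, by ext t; simpa [hφ] using h2 t t.2, rfl⟩
  have := LinearMap.finrank_range_add_finrank_ker φ
  rw [hr, finrank_top, ← Submodule.finrank_map_subtype_eq, hk] at this
  simp at this
  omega

open Classical in
/-- The two-dimensional subspaces of `W`. -/
def V2 {F V : Type*} [Field F] [AddCommGroup V] [Module F V] [Finite V]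
    (W : Submodule F V) : Finset (Submodule F V) :=
  (Set.toFinite {D : Submodule F V | D ≤ W ∧ Module.finrank F D = 2}).toFinset

lemma mem_V2 {F V : Type*} [Field F] [AddCommGroup V] [Module F V] [Finite V]
    {W D : Submodule F V} : D ∈ V2 W ↔ D ≤ W ∧ Module.finrank F D = 2 := by
  simp [V2]

lemma card_V2 {F V : Type*} [Field F] [Fintype F] [AddCommGroup V] [Module F V] [Finite V]
    (W : Submodule F V) (q d : ℕ) (hq : Fintype.card F = q) (hd : Module.finrank F W = d)
    (hd2 : 2 ≤ d) :
    (#(V2 W) : ℚ) * ((q ^ 2 - 1) * (q ^ 2 - q)) = (q ^ d - 1) * (q ^ d - q) := by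
  classical
  have : Fintype V := Fintype.ofFinite V
  have key : ∀ (W : Submodule F V) (d : ℕ), Module.finrank F W = d → 2 ≤ d →
      (Nat.card {s : Fin 2 → W // LinearIndependent F s} : ℚ) = (q ^ d - 1) * (q ^ d - q) := by
    intro W d hd hd2
    rw [card_linearIndependent (by omega), Fin.prod_univ_two, hd, hq]
    have hq1 : 1 ≤ q := hq ▸ Fintype.card_pos
    have h1 : 1 ≤ q ^ d := Nat.one_le_pow _ _ hq1
    have h2 : q ≤ q ^ d := Nat.le_self_pow (by omega) q
    simp only [Fin.val_zero, Fin.val_one, pow_zero, pow_one]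
    push_cast [Nat.cast_sub h1, Nat.cast_sub h2]
    rfl
  rw [← key W d hd hd2]
  let e : (Σ D : V2 W, {s : Fin 2 → D.1 // LinearIndependent F s}) ≃
      {s : Fin 2 → W // LinearIndependent F s} := by
    refine Equiv.ofBijective (fun x => ⟨fun i => ⟨(x.2.1 i : V), (mem_V2.1 x.1.2).1 (x.2.1 i).2⟩, ?_⟩) ⟨?_, ?_⟩
    · have := x.2.2.map' (Submodule.inclusion (mem_V2.1 x.1.2).1) (Submodule.ker_inclusion _ _ _)
      exact this
    · have hsp : ∀ x : (Σ D : V2 W, {s : Fin 2 → D.1 // LinearIndependent F s}),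
          Submodule.span F (Set.range fun i => (x.2.1 i : V)) = x.1.1 := by
        rintro ⟨⟨D, hD⟩, ⟨s, hs⟩⟩
        have h2 : LinearIndependent F (fun i => (s i : V)) := hs.map' D.subtype (Submodule.ker_subtype _)
        apply Submodule.eq_of_le_of_finrank_eq
        · rw [Submodule.span_le]; rintro _ ⟨i, rfl⟩; exact (s i).2
        · rw [finrank_span_eq_card h2]; simp [(mem_V2.1 hD).2]
      intro x y hxy
      have h1 : ∀ i, (x.2.1 i : V) = y.2.1 i := by
        intro i
        have := congrFun (congrArg Subtype.val hxy) i
        exact congrArg Subtype.val this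
      have h2 : x.1 = y.1 := by
        apply Subtype.ext
        rw [← hsp x, ← hsp y]
        congr 2
        ext1 i; exact h1 i
      obtain ⟨D, s⟩ := x
      obtain ⟨D', s'⟩ := y
      obtain rfl : D = D' := h2
      congr 1
      apply Subtype.ext
      funext i
      exact Subtype.ext (h1 i)
    · rintro ⟨s, hs⟩
      have h2 : LinearIndependent F (fun i => (s i : V)) := hs.map' W.subtype (Submodule.ker_subtype _)
      let D := Submodule.span F (Set.range fun i => (s i : V))
      have hD : D ∈ V2 W := by
        rw [mem_V2]
        refine ⟨?_, ?_⟩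
        · rw [Submodule.span_le]; rintro _ ⟨i, rfl⟩; exact (s i).2
        · rw [finrank_span_eq_card h2]; simp
      refine ⟨⟨⟨D, hD⟩, ⟨fun i => ⟨s i, Submodule.subset_span ⟨i, rfl⟩⟩, ?_⟩⟩, ?_⟩
      · exact LinearIndependent.of_comp D.subtype h2
      · rfl
  rw [← Nat.card_congr e, Nat.card_sigma]
  push_cast
  rw [Finset.sum_congr rfl (fun D _ => key D.1 2 (mem_V2.1 D.2).2 le_rfl)]
  simp

end VG
section VG2
open Finset

/-- The combinatorial properties of the plane and its code of conics used in the count. -/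
structure VGeom {F P L : Type*} [Field F] [Fintype F] [Fintype P] [Fintype L] [DecidableEq P]
    (C : Submodule F (P → F)) (I : L → Finset P) (q : ℕ) : Prop where
  cardF : Fintype.card F = q
  q4 : 4 ≤ q
  cardP : Fintype.card P = q ^ 2 + q + 1
  cardL : Fintype.card L = q ^ 2 + q + 1
  card_line : ∀ l, #(I l) = q + 1
  line : ∀ a b, a ≠ b → ∃ l, a ∈ I l ∧ b ∈ I l
  uniq : ∀ a b l m, a ≠ b → a ∈ I l → b ∈ I l → a ∈ I m → b ∈ I m → l = m
  sep : ∀ a b, a ≠ b → ∃ l, a ∈ I l ∧ b ∉ I l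
  rank : Module.finrank F C = 6
  prod : ∀ l m, ∃ c ∈ C, ∀ p, c p = 0 ↔ p ∈ I l ∨ p ∈ I m
  van : ∀ l a b c, a ∈ I l → b ∈ I l → c ∈ I l → a ≠ b → a ≠ c → b ≠ c →
    ∀ f ∈ C, f a = 0 → f b = 0 → f c = 0 → ∀ p ∈ I l, f p = 0

namespace VGeom
variable {F P L : Type*} [Field F] [Fintype F] [Fintype P] [Fintype L] [DecidableEq P]
    {C : Submodule F (P → F)} {I : L → Finset P} {q : ℕ}

lemma rank_le_three (G : VGeom C I q) (S : Finset P) (hS : #S ≤ 3) :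
    Module.finrank F (VK C S) + #S = 6 := by
  rw [← G.rank]
  apply VK_rank
  intro p hp
  have h2 : #(S.erase p) ≤ 2 := by rw [card_erase_of_mem hp]; omega
  obtain ⟨l0, hl0⟩ : ∃ l, p ∉ I l := by
    have : ∃ a, a ≠ p := by
      have : Nontrivial P := by
        rw [← Fintype.one_lt_card_iff_nontrivial, G.cardP]; nlinarith [G.q4]
      obtain ⟨x, y, hxy⟩ := this
      by_cases hx : x = p
      · exact ⟨y, fun h => hxy (hx.trans h.symm)⟩
      · exact ⟨x, hx⟩
    obtain ⟨a, ha⟩ := this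
    obtain ⟨l, _, h⟩ := G.sep a p ha
    exact ⟨l, h⟩
  have key : ∃ l m, p ∉ I l ∧ p ∉ I m ∧ ∀ x ∈ S.erase p, x ∈ I l ∨ x ∈ I m := by
    rcases Nat.lt_or_ge 1 #(S.erase p) with h | h
    · obtain ⟨a, b, hab, he⟩ := card_eq_two.1 (show #(S.erase p) = 2 by omega)
      have ha : a ≠ p := by
        have : a ∈ S.erase p := by simp [he]
        exact (mem_erase.1 this).1
      have hb : b ≠ p := by
        have : b ∈ S.erase p := by simp [he]
        exact (mem_erase.1 this).1
      obtain ⟨l, h1, h2⟩ := G.sep a p ha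
      obtain ⟨m, h3, h4⟩ := G.sep b p hb
      refine ⟨l, m, h2, h4, ?_⟩
      rw [he]; intro x hx
      simp at hx
      rcases hx with rfl | rfl <;> simp [*]
    · have : Nonempty P := ⟨p⟩
      rcases card_le_one_iff_subset_singleton.1 h with ⟨x, hx⟩
      by_cases hxp : x = p
      · refine ⟨l0, l0, hl0, hl0, fun y hy => ?_⟩
        have := hx hy
        simp at this
        exact absurd (this.trans hxp) (mem_erase.1 hy).1
      · obtain ⟨l, h1, h2⟩ := G.sep x p hxp
        refine ⟨l, l, h2, h2, fun y hy => ?_⟩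
        have := hx hy
        simp at this
        simp [this, h1]
  obtain ⟨l, m, h1, h2, h3⟩ := key
  obtain ⟨c, hc, hc'⟩ := G.prod l m
  exact ⟨c, hc, by rw [Ne, hc']; tauto, fun p' hp' hne => (hc' p').2 (h3 p' (mem_erase.2 ⟨hne, hp'⟩))⟩

lemma rank_four (G : VGeom C I q) (S : Finset P) (hS : #S = 4) (hn : ¬ ∃ l, S ⊆ I l) :
    Module.finrank F (VK C S) = 2 := by
  suffices Module.finrank F (VK C S) + #S = 6 by omega
  rw [← G.rank]
  apply VK_rank
  intro p hp
  have h2 : #(S.erase p) = 3 := by rw [card_erase_of_mem hp]; omega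
  obtain ⟨a, b, c, hab, hac, hbc, he⟩ := card_eq_three.1 h2
  have hmem : ∀ x, x ∈ S ↔ x = p ∨ x = a ∨ x = b ∨ x = c := by
    intro x
    have : x ∈ S.erase p ↔ x = a ∨ x = b ∨ x = c := by rw [he]; simp
    rw [mem_erase] at this
    by_cases hx : x = p
    · simp [hx, hp]
    · simpa [hx] using this
  have hne : ∀ x ∈ S.erase p, x ≠ p := fun x hx => (mem_erase.1 hx).1
  have ha : a ≠ p := hne a (by simp [he])
  have hb : b ≠ p := hne b (by simp [he])
  have hc : c ≠ p := hne c (by simp [he])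
  have key : ∃ l m, p ∉ I l ∧ p ∉ I m ∧ ∀ x ∈ S.erase p, x ∈ I l ∨ x ∈ I m := by
    obtain ⟨l, hla, hlb⟩ := G.line a b hab
    obtain ⟨m, hma, hmc⟩ := G.line a c hac
    by_cases hpl : p ∈ I l
    · by_cases hpm : p ∈ I m
      · exfalso
        have : l = m := G.uniq a p l m ha hla hpl hma hpm
        subst this
        apply hn
        refine ⟨l, fun x hx => ?_⟩
        rcases (hmem x).1 hx with rfl | rfl | rfl | rfl <;> assumption
      · obtain ⟨k, h1, h2⟩ := G.sep b p hb
        refine ⟨m, k, hpm, h2, ?_⟩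
        rw [he]; intro x hx
        simp at hx
        rcases hx with rfl | rfl | rfl <;> simp [*]
    · obtain ⟨k, h1, h2⟩ := G.sep c p hc
      refine ⟨l, k, hpl, h2, ?_⟩
      rw [he]; intro x hx
      simp at hx
      rcases hx with rfl | rfl | rfl <;> simp [*]
  obtain ⟨l, m, h1, h2, h3⟩ := key
  obtain ⟨c, hc, hc'⟩ := G.prod l m
  exact ⟨c, hc, by rw [Ne, hc']; tauto, fun p' hp' hne => (hc' p').2 (h3 p' (mem_erase.2 ⟨hne, hp'⟩))⟩

open Classical in
/-- Common zeros of a space of words. -/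
def Base (D : Submodule F (P → F)) : Finset P := univ.filter fun p => ∀ c ∈ D, c p = 0

lemma mem_Base {D : Submodule F (P → F)} {p : P} : p ∈ Base D ↔ ∀ c ∈ D, c p = 0 := by
  simp [Base]

lemma le_VK {D : Submodule F (P → F)} (hD : D ≤ C) (S : Finset P) : D ≤ VK C S ↔ S ⊆ Base D := by
  constructor
  · intro h p hp
    rw [mem_Base]
    exact fun c hc => (h hc).2 p hp
  · intro h c hc
    exact ⟨hD hc, fun p hp => mem_Base.1 (h hp) c hc⟩

/-- A set of zeros with three points on a line can be enlarged by the line. -/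
lemma VK_line (G : VGeom C I q) (S : Finset P) (l : L) (h : 3 ≤ #(S ∩ I l)) :
    VK C (S ∪ I l) = VK C S := by
  obtain ⟨a, b, c, ha, hb, hc, hab, hac, hbc⟩ := two_lt_card_iff.1 h
  rw [mem_inter] at ha hb hc
  ext f
  rw [mem_VK, mem_VK]
  refine and_congr_right fun hf => ⟨fun h p hp => h p (mem_union_left _ hp), fun h p hp => ?_⟩
  rcases mem_union.1 hp with hp | hp
  · exact h p hp
  · exact G.van l a b c ha.2 hb.2 hc.2 hab hac hbc f hf (h a ha.1) (h b hb.1) (h c hc.1) p hp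

lemma inter_le (G : VGeom C I q) {l m : L} (h : l ≠ m) : #(I l ∩ I m) ≤ 1 := by
  by_contra hc
  obtain ⟨a, b, ha, hb, hab⟩ := one_lt_card_iff.1 (not_le.1 hc)
  rw [mem_inter] at ha hb
  exact h (G.uniq a b l m hab ha.1 hb.1 ha.2 hb.2)

lemma rank_line (G : VGeom C I q) (l : L) : Module.finrank F (VK C (I l)) = 3 := by
  obtain ⟨S, hS, hc⟩ := exists_subset_card_eq (show 3 ≤ #(I l) by rw [G.card_line]; have := G.q4; omega)
  have := G.VK_line S l (by rw [inter_eq_left.2 hS]; omega)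
  rw [union_eq_right.2 hS] at this
  rw [this]
  have := G.rank_le_three S (by omega)
  omega

lemma rank_coll (G : VGeom C I q) (S : Finset P) (h : 3 ≤ #S) (l : L) (hS : S ⊆ I l) :
    Module.finrank F (VK C S) = 3 := by
  have := G.VK_line S l (by rw [inter_eq_left.2 hS]; omega)
  rw [union_eq_right.2 hS] at this
  rw [← this, G.rank_line]

lemma rank_line_point (G : VGeom C I q) (l : L) (p : P) (hp : p ∉ I l) :
    Module.finrank F (VK C (insert p (I l))) = 2 := by
  have := G.q4
  obtain ⟨S, hS, hc⟩ := exists_subset_card_eq (show 3 ≤ #(I l) by rw [G.card_line]; omega)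
  have hpS : p ∉ S := fun h => hp (hS h)
  have h1 := G.VK_line (insert p S) l (by
    rw [← hc]; apply card_le_card
    intro x hx; simp [hx, hS hx])
  have h2 : insert p S ∪ I l = insert p (I l) := by
    rw [insert_union, union_eq_right.2 hS]
  rw [← h2, h1]
  apply G.rank_four _ (by rw [card_insert_of_notMem hpS, hc])
  rintro ⟨m, hm⟩
  have : l = m := by
    by_contra hne
    have h3 := G.inter_le hne
    have : #S ≤ #(I l ∩ I m) := card_le_card fun x hx =>
      mem_inter.2 ⟨hS hx, hm (mem_insert_of_mem hx)⟩
    omega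
  subst this
  exact hp (hm (mem_insert_self _ _))

lemma eq_VK {D : Submodule F (P → F)} (hD : D ∈ V2 C) {S : Finset P} (hS : S ⊆ Base D)
    (h : Module.finrank F (VK C S) = 2) : D = VK C S := by
  have := mem_V2.1 hD
  exact Submodule.eq_of_le_of_finrank_eq ((le_VK this.1 S).2 hS) (by rw [h, this.2])

/-- A pencil whose base contains a line and a point off it. -/
lemma base_line_point (G : VGeom C I q) {D : Submodule F (P → F)} (hD : D ∈ V2 C) (l : L) (p : P)
    (hp : p ∉ I l) (hl : I l ⊆ Base D) (hpD : p ∈ Base D) : Base D = insert p (I l) := by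
  apply subset_antisymm
  · have := eq_VK hD (insert_subset hpD hl) (G.rank_line_point l p hp)
    intro x hx
    by_contra hn
    simp only [mem_insert, not_or] at hn
    obtain ⟨m, h1, h2⟩ := G.sep p x (Ne.symm hn.1)
    obtain ⟨c, hc, hc'⟩ := G.prod l m
    have hcD : c ∈ D := by
      rw [this, mem_VK]
      refine ⟨hc, fun y hy => (hc' y).2 ?_⟩
      rcases mem_insert.1 hy with rfl | hy
      · exact Or.inr h1
      · exact Or.inl hy
    have := (hc' x).1 (mem_Base.1 hx c hcD)
    tauto
  · exact insert_subset hpD hl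

lemma line_sub (G : VGeom C I q) {D : Submodule F (P → F)} (hD : D ∈ V2 C) (l : L)
    (h : 3 ≤ #(Base D ∩ I l)) : I l ⊆ Base D := by
  have h1 := (le_VK (mem_V2.1 hD).1 (Base D)).2 subset_rfl
  rw [← G.VK_line _ l h, le_VK (mem_V2.1 hD).1] at h1
  exact subset_union_right.trans h1

lemma exists_line (G : VGeom C I q) {D : Submodule F (P → F)} (hD : D ∈ V2 C)
    (h : 5 ≤ #(Base D)) : ∃ l, I l ⊆ Base D := by
  by_contra hn
  have hn' : ∀ l, #(Base D ∩ I l) ≤ 2 := by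
    intro l
    by_contra hc
    exact hn ⟨l, G.line_sub hD l (by omega)⟩
  have hcol : ∀ a b c l, a ∈ Base D → b ∈ Base D → c ∈ Base D → a ≠ b → a ≠ c → b ≠ c →
      a ∈ I l → b ∈ I l → c ∉ I l := by
    intro a b c l ha hb hc hab hac hbc hal hbl hcl
    have : 2 < #(Base D ∩ I l) := two_lt_card_iff.2
      ⟨a, b, c, mem_inter.2 ⟨ha, hal⟩, mem_inter.2 ⟨hb, hbl⟩, mem_inter.2 ⟨hc, hcl⟩, hab, hac, hbc⟩
    have := hn' l
    omega
  obtain ⟨S, hS, hc⟩ := exists_subset_card_eq h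
  obtain ⟨e, he⟩ := card_pos.1 (show 0 < #S by omega)
  have h4 : #(S.erase e) = 4 := by rw [card_erase_of_mem he]; omega
  obtain ⟨a, ha⟩ := card_pos.1 (show 0 < #(S.erase e) by omega)
  have h3 : #((S.erase e).erase a) = 3 := by rw [card_erase_of_mem ha]; omega
  obtain ⟨b, c, d, hbc, hbd, hcd, hbcd⟩ := card_eq_three.1 h3
  have hb : b ∈ (S.erase e).erase a := by simp [hbcd]
  have hc : c ∈ (S.erase e).erase a := by simp [hbcd]
  have hd : d ∈ (S.erase e).erase a := by simp [hbcd]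
  simp only [mem_erase] at ha hb hc hd
  have hab : a ≠ b := Ne.symm hb.1
  have hac : a ≠ c := Ne.symm hc.1
  have had : a ≠ d := Ne.symm hd.1
  obtain ⟨l, hla, hlb⟩ := G.line a b hab
  obtain ⟨m, hmc, hmd⟩ := G.line c d hcd
  obtain ⟨f, hf, hf'⟩ := G.prod l m
  let T : Finset P := {a, b, c, d}
  have hT : #T = 4 := by simp [T, *]
  have hTD : T ⊆ Base D := by
    intro x hx
    simp [T] at hx
    rcases hx with rfl | rfl | rfl | rfl <;> apply hS <;> tauto
  have hD' := eq_VK hD hTD (G.rank_four T hT (by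
    rintro ⟨l, hl⟩
    have := card_le_card (subset_inter hTD hl)
    have := hn' l
    omega))
  have hfD : f ∈ D := by
    rw [hD', mem_VK]
    refine ⟨hf, fun x hx => (hf' x).2 ?_⟩
    simp [T] at hx
    rcases hx with rfl | rfl | rfl | rfl <;> tauto
  rcases (hf' e).1 (mem_Base.1 (hS he) f hfD) with h | h
  · exact hcol a b e l (hS ha.2) (hS hb.2.2) (hS he) hab ha.1 hb.2.1 hla hlb h
  · exact hcol c d e m (hS hc.2.2) (hS hd.2.2) (hS he) hcd hc.2.1 hd.2.1 hmc hmd h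

/-- Dichotomy for pencils with a line in the base. -/
lemma base_cases (G : VGeom C I q) {D : Submodule F (P → F)} (hD : D ∈ V2 C) (l : L)
    (hl : I l ⊆ Base D) : Base D = I l ∨ ∃ p ∉ I l, Base D = insert p (I l) := by
  by_cases h : Base D ⊆ I l
  · exact Or.inl (subset_antisymm h hl)
  · obtain ⟨p, hp, hpl⟩ := not_subset.1 h
    exact Or.inr ⟨p, hpl, G.base_line_point hD l p hpl hl hp⟩

lemma line_unique (G : VGeom C I q) {D : Submodule F (P → F)} (hD : D ∈ V2 C) (l m : L)
    (hl : I l ⊆ Base D) (hm : I m ⊆ Base D) : l = m := by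
  by_contra hne
  have h1 := G.inter_le hne
  have h2 := card_union_add_card_inter (I l) (I m)
  have h3 := card_le_card (union_subset hl hm)
  have h4 : #(Base D) ≤ q + 2 := by
    rcases G.base_cases hD l hl with h | ⟨p, hp, h⟩
    · rw [h, G.card_line]; omega
    · rw [h, card_insert_of_notMem hp, G.card_line]
  have := G.q4
  rw [G.card_line, G.card_line] at h2
  omega

lemma base_card (G : VGeom C I q) {D : Submodule F (P → F)} (hD : D ∈ V2 C) :
    #(Base D) ≤ 4 ∨ #(Base D) = q + 1 ∨ #(Base D) = q + 2 := by
  rcases Nat.lt_or_ge 4 #(Base D) with h | h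
  · obtain ⟨l, hl⟩ := G.exists_line hD h
    rcases G.base_cases hD l hl with h | ⟨p, hp, h⟩
    · rw [h, G.card_line]; omega
    · rw [h, card_insert_of_notMem hp, G.card_line]; omega
  · exact Or.inl h

end VGeom
end VG2
section VG3
open Finset

lemma q_choose (n : ℕ) : ((n.choose 2 : ℕ) : ℚ) = n * (n - 1) / 2 ∧
    ((n.choose 3 : ℕ) : ℚ) = n * (n - 1) * (n - 2) / 6 ∧
    ((n.choose 4 : ℕ) : ℚ) = n * (n - 1) * (n - 2) * (n - 3) / 24 := by
  induction n with
  | zero => simp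
  | succ n ih =>
    obtain ⟨h2, h3, h4⟩ := ih
    refine ⟨?_, ?_, ?_⟩
    · rw [Nat.choose_succ_succ' n 1]; push_cast; rw [h2, Nat.choose_one_right]; ring
    · rw [Nat.choose_succ_succ' n 2]; push_cast; rw [h2, h3]; ring
    · rw [Nat.choose_succ_succ' n 3]; push_cast; rw [h4, h3]; ring

namespace VGeom
variable {F P L : Type*} [Field F] [Fintype F] [Fintype P] [Fintype L] [DecidableEq P]
    {C : Submodule F (P → F)} {I : L → Finset P} {q : ℕ}

open Classical in
/-- Number of pencils with `n` base points. -/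
def BN (C : Submodule F (P → F)) (n : ℕ) : ℕ := #((V2 C).filter fun D => #(Base D) = n)

lemma V2_filter (S : Finset P) [DecidablePred fun D : Submodule F (P → F) => S ⊆ Base D] :
    (V2 C).filter (fun D => S ⊆ Base D) = V2 (VK C S) := by
  ext D
  rw [mem_filter, mem_V2, mem_V2]
  constructor
  · rintro ⟨⟨h1, h2⟩, h3⟩
    exact ⟨(le_VK h1 S).2 h3, h2⟩
  · rintro ⟨h1, h2⟩
    have h : D ≤ C := fun c hc => (h1 hc).1
    exact ⟨⟨h, h2⟩, (le_VK h S).1 h1⟩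

open Classical in
lemma V2_card_sum (S : Finset P) :
    (#(V2 (VK C S)) : ℚ) = ∑ D ∈ V2 C, if S ⊆ Base D then (1 : ℚ) else 0 := by
  rw [← V2_filter, ← sum_filter, sum_const, nsmul_eq_mul, mul_one]

/-- Double counting. -/
lemma moment (k : ℕ) :
    ∑ D ∈ V2 C, (#(Base D)).choose k = ∑ S ∈ powersetCard k (univ : Finset P), #(V2 (VK C S)) := by
  classical
  simp_rw [← V2_filter, card_eq_sum_ones, sum_filter]
  rw [sum_comm]
  refine sum_congr rfl fun D _ => ?_
  rw [← card_eq_sum_ones, ← card_powersetCard, card_eq_sum_ones, ← sum_filter]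
  refine sum_congr ?_ fun _ _ => rfl
  ext S
  simp [mem_powersetCard, and_comm]

/-- Splitting a sum over pencils by number of base points. -/
lemma sum_split (G : VGeom C I q) (f : ℕ → ℚ) :
    ∑ D ∈ V2 C, f #(Base D) = BN C 0 * f 0 + BN C 1 * f 1 + BN C 2 * f 2 + BN C 3 * f 3 +
      BN C 4 * f 4 + BN C (q + 1) * f (q + 1) + BN C (q + 2) * f (q + 2) := by
  classical
  have hq := G.q4
  have : ∀ D ∈ V2 C, #(Base D) ∈ ({0, 1, 2, 3, 4, q + 1, q + 2} : Finset ℕ) := by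
    intro D hD
    have := G.base_card hD
    simp only [mem_insert, mem_singleton]
    omega
  rw [← sum_fiberwise_of_maps_to this]
  have h2 : ∀ n, ∑ D ∈ V2 C with #(Base D) = n, f #(Base D) = BN C n * f n := by
    intro n
    rw [sum_congr rfl (g := fun _ => f n) (fun D hD => by rw [(mem_filter.1 hD).2])]
    rw [sum_const, nsmul_eq_mul]
    congr
  simp_rw [h2]
  rw [sum_insert, sum_insert, sum_insert, sum_insert, sum_insert, sum_insert, sum_singleton]
  · ring
  all_goals simp only [mem_insert, mem_singleton]; omega

lemma N_eq (G : VGeom C I q) (W : Submodule F (P → F)) (d : ℕ) (x : ℚ)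
    (hd : Module.finrank F W = d) (hd2 : 2 ≤ d)
    (hx : x * (((q : ℚ) ^ 2 - 1) * (q ^ 2 - q)) = (q ^ d - 1) * (q ^ d - q)) :
    (#(V2 W) : ℚ) = x := by
  have h := card_V2 W q d G.cardF hd hd2
  rw [← hx] at h
  have hq : (4 : ℚ) ≤ q := by exact_mod_cast G.q4
  refine mul_right_cancel₀ (ne_of_gt ?_) h
  apply mul_pos <;> nlinarith

lemma N_two (G : VGeom C I q) (W : Submodule F (P → F)) (hd : Module.finrank F W = 2) :
    (#(V2 W) : ℚ) = 1 := G.N_eq W 2 _ hd le_rfl (by ring)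
lemma N_three (G : VGeom C I q) (W : Submodule F (P → F)) (hd : Module.finrank F W = 3) :
    (#(V2 W) : ℚ) = q ^ 2 + q + 1 := G.N_eq W 3 _ hd (by norm_num) (by ring)
lemma N_four (G : VGeom C I q) (W : Submodule F (P → F)) (hd : Module.finrank F W = 4) :
    (#(V2 W) : ℚ) = (q ^ 2 + 1) * (q ^ 2 + q + 1) := G.N_eq W 4 _ hd (by norm_num) (by ring)
lemma N_five (G : VGeom C I q) (W : Submodule F (P → F)) (hd : Module.finrank F W = 5) :
    (#(V2 W) : ℚ) = (q ^ 4 + q ^ 3 + q ^ 2 + q + 1) * (q ^ 2 + 1) :=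
  G.N_eq W 5 _ hd (by norm_num) (by ring)
lemma N_six (G : VGeom C I q) (W : Submodule F (P → F)) (hd : Module.finrank F W = 6) :
    (#(V2 W) : ℚ) = (q ^ 4 + q ^ 3 + q ^ 2 + q + 1) * (q ^ 4 + q ^ 2 + 1) :=
  G.N_eq W 6 _ hd (by norm_num) (by ring)

lemma moment_low (G : VGeom C I q) (k : ℕ) (hk : k ≤ 3) (x : ℚ)
    (hx : ∀ W : Submodule F (P → F), Module.finrank F W = 6 - k → (#(V2 W) : ℚ) = x) :
    ∑ D ∈ V2 C, ((#(Base D)).choose k : ℚ) = ((q ^ 2 + q + 1).choose k : ℚ) * x := by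
  have := moment (C := C) k
  have h2 := congrArg (Nat.cast : ℕ → ℚ) this
  push_cast at h2
  rw [h2, sum_congr rfl (g := fun _ => x), sum_const, card_powersetCard, card_univ, G.cardP,
    nsmul_eq_mul]
  intro S hS
  have hS := (mem_powersetCard.1 hS).2
  apply hx
  have := G.rank_le_three S (by omega)
  omega

lemma card_coll (G : VGeom C I q) [DecidablePred fun S : Finset P => ∃ l, S ⊆ I l] :
    #((powersetCard 4 (univ : Finset P)).filter fun S => ∃ l, S ⊆ I l) =
      (q ^ 2 + q + 1) * (q + 1).choose 4 := by
  classical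
  have : (powersetCard 4 (univ : Finset P)).filter (fun S => ∃ l, S ⊆ I l) =
      (univ : Finset L).biUnion fun l => powersetCard 4 (I l) := by
    ext S
    simp [mem_powersetCard]
    tauto
  rw [this, card_biUnion]
  · simp [card_powersetCard, G.card_line, G.cardL]
  · intro l _ m _ hlm
    rw [Function.onFun, disjoint_left]
    intro S hS hS'
    rw [mem_powersetCard] at hS hS'
    have h1 := G.inter_le hlm
    have h2 := card_le_card (subset_inter hS.1 hS'.1)
    omega

lemma moment_four (G : VGeom C I q) :
    ∑ D ∈ V2 C, ((#(Base D)).choose 4 : ℚ) = ((q ^ 2 + q + 1).choose 4 : ℚ) +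
      (q ^ 2 + q) * ((q ^ 2 + q + 1) * ((q + 1).choose 4 : ℚ)) := by
  classical
  have := moment (C := C) 4
  have h2 := congrArg (Nat.cast : ℕ → ℚ) this
  push_cast at h2
  have h3 := G.card_coll
  have h3 := congrArg (Nat.cast : ℕ → ℚ) h3
  push_cast at h3
  rw [h2, ← h3, sum_congr rfl (g := fun S => (1 : ℚ) + if ∃ l, S ⊆ I l then (q ^ 2 + q : ℚ) else 0),
    sum_add_distrib, ← sum_filter, sum_const, sum_const, card_powersetCard, card_univ, G.cardP,
    nsmul_eq_mul, nsmul_eq_mul, mul_one, mul_comm (_ + _ : ℚ)]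
  intro S hS
  have hS := (mem_powersetCard.1 hS).2
  by_cases h : ∃ l, S ⊆ I l
  · obtain ⟨l, hl⟩ := id h
    rw [if_pos h, G.N_three _ (G.rank_coll S (by omega) l hl)]; ring
  · rw [if_neg h, G.N_two _ (G.rank_four S hS h)]; ring

lemma count_lines (G : VGeom C I q) :
    (BN C (q + 1) : ℚ) + BN C (q + 2) = (q ^ 2 + q + 1) ^ 2 := by
  classical
  have hq := G.q4
  have h1 : ∑ D ∈ V2 C, (if 5 ≤ #(Base D) then (1 : ℚ) else 0) = ∑ l : L, (#(V2 (VK C (I l))) : ℚ) := by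
    simp_rw [V2_card_sum]
    rw [sum_comm]
    refine sum_congr rfl fun D hD => ?_
    rw [← sum_filter, sum_const, nsmul_eq_mul, mul_one]
    split_ifs with h
    · obtain ⟨l, hl⟩ := G.exists_line hD h
      have : (univ.filter fun l => I l ⊆ Base D) = {l} := by
        ext m
        simp only [mem_filter, mem_univ, true_and, mem_singleton]
        exact ⟨fun hm => G.line_unique hD m l hm hl, fun e => e ▸ hl⟩
      rw [this]; simp
    · have : (univ.filter fun l => I l ⊆ Base D) = ∅ := by
        rw [filter_eq_empty_iff]
        intro m _ hm
        have := card_le_card hm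
        rw [G.card_line] at this
        omega
      rw [this]; simp
  rw [G.sum_split fun n => if 5 ≤ n then (1 : ℚ) else 0, sum_congr rfl (fun l _ => G.N_three _ (G.rank_line l)),
    sum_const, card_univ, G.cardL, nsmul_eq_mul] at h1
  rw [if_pos (show 5 ≤ q + 1 by omega), if_pos (show 5 ≤ q + 2 by omega)] at h1
  norm_num at h1
  rw [h1]; ring

lemma count_line_points (G : VGeom C I q) :
    (BN C (q + 2) : ℚ) = (q ^ 2 + q + 1) * q ^ 2 := by
  classical
  have hq := G.q4
  let X : Finset (L × P) := univ.filter fun x => x.2 ∉ I x.1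
  have hX : #X = (q ^ 2 + q + 1) * q ^ 2 := by
    have : X = Finset.map (α := Σ _ : L, P) (Equiv.sigmaEquivProd L P).toEmbedding
        ((univ : Finset L).sigma (fun l => univ \ I l)) := by
      ext ⟨l, p⟩
      simp [X]
    rw [this, card_map, card_sigma]
    have : ∀ l, #(univ \ I l) = q ^ 2 := by
      intro l
      rw [card_sdiff_of_subset (subset_univ _), card_univ, G.cardP, G.card_line]
      omega
    simp [this, G.cardL]
  have h1 : ∑ D ∈ V2 C, (if #(Base D) = q + 2 then (1 : ℚ) else 0) =
      ∑ x ∈ X, (#(V2 (VK C (insert x.2 (I x.1)))) : ℚ) := by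
    simp_rw [V2_card_sum]
    rw [sum_comm]
    refine sum_congr rfl fun D hD => ?_
    rw [← sum_filter, sum_const, nsmul_eq_mul, mul_one]
    split_ifs with h
    · obtain ⟨l, hl⟩ := G.exists_line hD (by omega)
      rcases G.base_cases hD l hl with h' | ⟨p, hp, h'⟩
      · rw [h', G.card_line] at h; omega
      have : (X.filter fun x => insert x.2 (I x.1) ⊆ Base D) = {(l, p)} := by
        ext ⟨m, r⟩
        simp only [X, mem_filter, mem_univ, true_and, mem_singleton, Prod.mk.injEq]
        constructor
        · rintro ⟨h1, h2⟩
          rw [insert_subset_iff] at h2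
          have e := G.line_unique hD m l h2.2 hl
          subst e
          refine ⟨rfl, ?_⟩
          have := h2.1
          rw [h', mem_insert] at this
          tauto
        · rintro ⟨rfl, rfl⟩
          exact ⟨hp, h' ▸ subset_rfl⟩
      rw [this]; simp
    · have : (X.filter fun x => insert x.2 (I x.1) ⊆ Base D) = ∅ := by
        rw [filter_eq_empty_iff]
        rintro ⟨m, r⟩ hmr hm
        simp only [X, mem_filter, mem_univ, true_and] at hmr
        rw [insert_subset_iff] at hm
        have := G.base_line_point hD m r hmr hm.2 hm.1
        rw [this, card_insert_of_notMem hmr, G.card_line] at h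
        omega
      rw [this]; simp
  rw [G.sum_split fun n => if n = q + 2 then (1 : ℚ) else 0,
    sum_congr rfl (g := fun _ => (1 : ℚ)) (fun x hx => G.N_two _ (G.rank_line_point x.1 x.2 (mem_filter.1 hx).2)),
    sum_const, hX, nsmul_eq_mul] at h1
  rw [if_neg (by omega), if_neg (by omega), if_neg (by omega), if_neg (by omega), if_neg (by omega),
    if_neg (by omega), if_pos rfl] at h1
  push_cast at h1
  linarith

lemma solve (G : VGeom C I q) :
    (BN C (q + 2) : ℚ) = (q : ℚ) ^ 4 + q ^ 3 + q ^ 2 ∧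
    (BN C (q + 1) : ℚ) = (q : ℚ) ^ 3 + 2 * q ^ 2 + 2 * q + 1 ∧
    (BN C 4 : ℚ) = ((q : ℚ) ^ 8 - q ^ 6 - q ^ 5 + q ^ 3) / 24 ∧
    (BN C 3 : ℚ) = ((q : ℚ) ^ 7 + q ^ 6 - q ^ 4 - q ^ 3) / 2 ∧
    (BN C 2 : ℚ) =
      ((q : ℚ) ^ 8 + 5 * q ^ 6 + 7 * q ^ 5 + 4 * q ^ 4 - q ^ 3 - 4 * q ^ 2) / 4 ∧
    (BN C 1 : ℚ) =
      (2 * (q : ℚ) ^ 8 + 3 * q ^ 7 + q ^ 6 + 4 * q ^ 5 + 9 * q ^ 4 + 5 * q ^ 3 - 6 * q) / 6 ∧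
    (BN C 0 : ℚ) =
      (3 * (q : ℚ) ^ 8 + q ^ 6 - 3 * q ^ 5 - q ^ 3) / 8 := by
  have a2 := G.count_line_points
  have a1 := G.count_lines
  have m0 := G.moment_low 0 (by norm_num) _ G.N_six
  have m1 := G.moment_low 1 (by norm_num) _ G.N_five
  have m2 := G.moment_low 2 (by norm_num) _ G.N_four
  have m3 := G.moment_low 3 (by norm_num) _ G.N_three
  have m4 := G.moment_four
  rw [G.sum_split fun n => (n.choose 0 : ℚ)] at m0
  rw [G.sum_split fun n => (n.choose 1 : ℚ)] at m1
  rw [G.sum_split fun n => (n.choose 2 : ℚ)] at m2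
  rw [G.sum_split fun n => (n.choose 3 : ℚ)] at m3
  rw [G.sum_split fun n => (n.choose 4 : ℚ)] at m4
  simp only [Nat.choose_zero_right, Nat.choose_one_right, (q_choose _).1, (q_choose _).2.1,
    (q_choose _).2.2] at m0 m1 m2 m3 m4
  push_cast at m0 m1 m2 m3 m4
  have b2 : (BN C (q + 2) : ℚ) = (q : ℚ) ^ 4 + q ^ 3 + q ^ 2 := by linarith
  have b1 : (BN C (q + 1) : ℚ) = (q : ℚ) ^ 3 + 2 * q ^ 2 + 2 * q + 1 := by linarith
  rw [b1, b2] at m0 m1 m2 m3 m4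
  have c4 : (BN C 4 : ℚ) = ((q : ℚ) ^ 8 - q ^ 6 - q ^ 5 + q ^ 3) / 24 := by linarith
  rw [c4] at m0 m1 m2 m3
  have c3 : (BN C 3 : ℚ) = ((q : ℚ) ^ 7 + q ^ 6 - q ^ 4 - q ^ 3) / 2 := by linarith
  rw [c3] at m0 m1 m2
  have c2 : (BN C 2 : ℚ) =
      ((q : ℚ) ^ 8 + 5 * q ^ 6 + 7 * q ^ 5 + 4 * q ^ 4 - q ^ 3 - 4 * q ^ 2) / 4 := by linarith
  rw [c2] at m0 m1
  have c1 : (BN C 1 : ℚ) =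
      (2 * (q : ℚ) ^ 8 + 3 * q ^ 7 + q ^ 6 + 4 * q ^ 5 + 9 * q ^ 4 + 5 * q ^ 3 - 6 * q) / 6 := by
    linarith
  rw [c1] at m0
  exact ⟨b2, b1, c4, c3, c2, c1, by linarith⟩

lemma BN_zero (G : VGeom C I q) (n : ℕ) (h0 : 4 < n) (h1 : n ≠ q + 1) (h2 : n ≠ q + 2) :
    BN C n = 0 := by
  rw [BN, card_eq_zero, filter_eq_empty_iff]
  intro D hD h
  have := G.base_card hD
  omega

end VGeom
end VG3
section VG4
open Finset Projectivization

/-- Value of the ternary quadratic form with coefficients `a` at `v`. -/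
def quadV {F : Type*} [Field F] (a : Fin 6 → F) (v : Fin 3 → F) : F :=
  a 0 * v 0 ^ 2 + a 1 * v 1 ^ 2 + a 2 * v 2 ^ 2 + a 3 * (v 0 * v 1) + a 4 * (v 0 * v 2) +
    a 5 * (v 1 * v 2)

/-- The evaluation map on coefficient vectors. -/
def quadL {F P : Type*} [Field F] (rep : P → (Fin 3 → F)) : (Fin 6 → F) →ₗ[F] (P → F) where
  toFun a := fun p => quadV a (rep p)
  map_add' a b := by ext p; simp [quadV]; ring
  map_smul' r a := by ext p; simp [quadV]; ring

lemma quadL_apply {F P : Type*} [Field F] (rep : P → (Fin 3 → F)) (a : Fin 6 → F) (p : P) :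
    quadL rep a p = quadV a (rep p) := rfl

lemma veronese_eq_range {F : Type*} [Field F] (rep : Plane F → (Fin 3 → F)) :
    VeroneseCode rep = LinearMap.range (quadL rep) := by
  apply le_antisymm
  · rintro _ ⟨f, hf, rfl⟩
    have hf : f.IsHomogeneous 2 := hf
    rw [f.as_sum, map_sum]
    refine Submodule.sum_mem _ fun d hd => ?_
    have h2 : d.degree = 2 := by
      have := hf (MvPolynomial.mem_support_iff.1 hd)
      rw [Finsupp.degree_eq_weight_one]
      exact this
    rw [Finsupp.degree_eq_sum, Fin.sum_univ_three] at h2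
    have hev : ∀ p, (LinearMap.pi fun p => (MvPolynomial.aeval (rep p)).toLinearMap)
        (monomial d (coeff d f)) p =
        coeff d f * (rep p 0 ^ d 0 * rep p 1 ^ d 1 * rep p 2 ^ d 2) := by
      intro p
      simp [MvPolynomial.aeval_monomial, Finsupp.prod_fintype, Fin.prod_univ_three]
    have hcase : (d 0 = 2 ∧ d 1 = 0 ∧ d 2 = 0) ∨ (d 0 = 0 ∧ d 1 = 2 ∧ d 2 = 0) ∨
      (d 0 = 0 ∧ d 1 = 0 ∧ d 2 = 2) ∨ (d 0 = 1 ∧ d 1 = 1 ∧ d 2 = 0) ∨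
      (d 0 = 1 ∧ d 1 = 0 ∧ d 2 = 1) ∨ (d 0 = 0 ∧ d 1 = 1 ∧ d 2 = 1) := by omega
    rcases hcase with ⟨h0, h1, h2⟩ | ⟨h0, h1, h2⟩ | ⟨h0, h1, h2⟩ | ⟨h0, h1, h2⟩ | ⟨h0, h1, h2⟩ |
      ⟨h0, h1, h2⟩
    · exact ⟨Pi.single 0 (coeff d f), by
        ext p; rw [hev, quadL_apply, quadV, h0, h1, h2]; simp⟩
    · exact ⟨Pi.single 1 (coeff d f), by
        ext p; rw [hev, quadL_apply, quadV, h0, h1, h2]; simp⟩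
    · exact ⟨Pi.single 2 (coeff d f), by
        ext p; rw [hev, quadL_apply, quadV, h0, h1, h2]; simp⟩
    · exact ⟨Pi.single 3 (coeff d f), by
        ext p; rw [hev, quadL_apply, quadV, h0, h1, h2]; simp⟩
    · exact ⟨Pi.single 4 (coeff d f), by
        ext p; rw [hev, quadL_apply, quadV, h0, h1, h2]; simp⟩
    · exact ⟨Pi.single 5 (coeff d f), by
        ext p; rw [hev, quadL_apply, quadV, h0, h1, h2]; simp⟩
  · rintro _ ⟨a, rfl⟩
    have hX : ∀ (r : F) (i j : Fin 3),
        (MvPolynomial.C r * (X i * X j) : MvPolynomial (Fin 3) F).IsHomogeneous 2 := by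
      intro r i j
      have := (isHomogeneous_C (Fin 3) r).mul ((isHomogeneous_X F i).mul (isHomogeneous_X F j))
      simpa using this
    refine ⟨MvPolynomial.C (a 0) * (X 0 * X 0) + MvPolynomial.C (a 1) * (X 1 * X 1) +
      MvPolynomial.C (a 2) * (X 2 * X 2) + MvPolynomial.C (a 3) * (X 0 * X 1) +
      MvPolynomial.C (a 4) * (X 0 * X 2) + MvPolynomial.C (a 5) * (X 1 * X 2), ?_, ?_⟩
    · exact (((((hX _ _ _).add (hX _ _ _)).add (hX _ _ _)).add (hX _ _ _)).add (hX _ _ _)).add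
        (hX _ _ _)
    · ext p
      rw [quadL_apply, quadV]
      simp
      ring

lemma rep_mk {F : Type*} [Field F] {rep : Plane F → (Fin 3 → F)}
    (hrep : ∀ p : Plane F, ∃ h : rep p ≠ 0, Projectivization.mk F (rep p) h = p)
    (v : Fin 3 → F) (hv : v ≠ 0) :
    ∃ u : F, u ≠ 0 ∧ rep (Projectivization.mk F v hv) = u • v := by
  obtain ⟨h, h'⟩ := hrep (Projectivization.mk F v hv)
  rw [Projectivization.mk_eq_mk_iff'] at h'
  obtain ⟨u, hu⟩ := h'
  refine ⟨u, ?_, hu.symm⟩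
  rintro rfl
  exact h (by rw [← hu, zero_smul])

lemma quadL_inj {F : Type*} [Field F] {rep : Plane F → (Fin 3 → F)}
    (hrep : ∀ p : Plane F, ∃ h : rep p ≠ 0, Projectivization.mk F (rep p) h = p)
    : Function.Injective (quadL rep) := by
  rw [← LinearMap.ker_eq_bot, LinearMap.ker_eq_bot']
  intro a ha
  have key : ∀ v : Fin 3 → F, v ≠ 0 → quadV a v = 0 := by
    intro v hv
    obtain ⟨u, hu, h⟩ := rep_mk hrep v hv
    have := congrFun ha (Projectivization.mk F v hv)
    rw [quadL_apply, h] at this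
    have h2 : quadV a (u • v) = u ^ 2 * quadV a v := by simp [quadV]; ring
    rw [h2] at this
    simpa [hu] using this
  have h0 := key ![1, 0, 0] (by simp)
  have h1 := key ![0, 1, 0] (by simp)
  have h2 := key ![0, 0, 1] (by simp)
  have h3 := key ![1, 1, 0] (by simp)
  have h4 := key ![1, 0, 1] (by simp)
  have h5 := key ![0, 1, 1] (by simp)
  simp [quadV] at h0 h1 h2 h3 h4 h5
  simp [h0, h1, h2] at h3 h4 h5
  ext i
  fin_cases i <;> simp [*]

lemma mem_iff_dot {F : Type*} [Field F] {rep : Plane F → (Fin 3 → F)}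
    (hrep : ∀ p : Plane F, ∃ h : rep p ≠ 0, Projectivization.mk F (rep p) h = p)
    (p l : Plane F) : p ∈ l ↔ rep p ⬝ᵥ rep l = 0 := by
  obtain ⟨h, hp⟩ := hrep p
  obtain ⟨h', hl⟩ := hrep l
  rw [Configuration.ofField.mem_iff, ← Projectivization.orthogonal_mk h h', hp, hl]

lemma rep_comb {F : Type*} [Field F] {rep : Plane F → (Fin 3 → F)}
    (hrep : ∀ p : Plane F, ∃ h : rep p ≠ 0, Projectivization.mk F (rep p) h = p)
    {a b l : Plane F} (hab : a ≠ b) (ha : a ∈ l) (hb : b ∈ l) {p : Plane F}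
    (hp : p ∈ l) : ∃ s t : F, rep p = s • rep a + t • rep b := by
  rw [mem_iff_dot hrep] at ha hb hp
  obtain ⟨hl0, -⟩ := hrep l
  let M : Matrix (Fin 3) (Fin 3) F := Matrix.of ![rep a, rep b, rep p]
  have hM : M.det = 0 := by
    rw [← Matrix.exists_mulVec_eq_zero_iff]
    refine ⟨rep l, hl0, ?_⟩
    ext i
    fin_cases i
    · exact ha
    · exact hb
    · exact hp
  obtain ⟨x, hx0, hx⟩ := Matrix.exists_vecMul_eq_zero_iff.2 hM
  have hx' : x 0 • rep a + x 1 • rep b + x 2 • rep p = 0 := by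
    ext j
    have := congrFun hx j
    simpa [Matrix.vecMul, dotProduct, Fin.sum_univ_three, M] using this
  by_cases h2 : x 2 = 0
  · exfalso
    obtain ⟨ha0, ha'⟩ := hrep a
    obtain ⟨hb0, hb'⟩ := hrep b
    rw [h2, zero_smul, add_zero] at hx'
    by_cases h0 : x 0 = 0
    · rw [h0, zero_smul, zero_add] at hx'
      have h1 : x 1 = 0 := (smul_eq_zero.1 hx').resolve_right hb0
      apply hx0
      ext i
      fin_cases i <;> simp [*]
    · apply hab
      rw [← ha', ← hb', Projectivization.mk_eq_mk_iff']
      refine ⟨-(x 0)⁻¹ * x 1, ?_⟩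
      have : x 0 • rep a = - (x 1 • rep b) := eq_neg_of_add_eq_zero_left hx'
      calc (-(x 0)⁻¹ * x 1) • rep b = (x 0)⁻¹ • (-(x 1 • rep b)) := by
            rw [smul_neg, ← neg_smul, smul_smul]
        _ = rep a := by rw [← this, smul_smul, inv_mul_cancel₀ h0, one_smul]
  · refine ⟨-(x 2)⁻¹ * x 0, -(x 2)⁻¹ * x 1, ?_⟩
    ext j
    have := congrFun hx' j
    simp at this ⊢
    field_simp
    linear_combination this

lemma veronese_van {F : Type*} [Field F] {rep : Plane F → (Fin 3 → F)}
    (hrep : ∀ p : Plane F, ∃ h : rep p ≠ 0, Projectivization.mk F (rep p) h = p)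
    (l a b c : Plane F) (ha : a ∈ l) (hb : b ∈ l) (hc : c ∈ l) (hab : a ≠ b)
    (hac : a ≠ c) (hbc : b ≠ c) (f : Plane F → F) (hf : f ∈ VeroneseCode rep) (fa : f a = 0)
    (fb : f b = 0) (fc : f c = 0) (p : Plane F) (hp : p ∈ l) : f p = 0 := by
  rw [veronese_eq_range] at hf
  obtain ⟨w, rfl⟩ := hf
  rw [quadL_apply] at *
  have key : ∃ B : F, ∀ s t : F, quadV w (s • rep a + t • rep b) =
      s ^ 2 * quadV w (rep a) + t ^ 2 * quadV w (rep b) + s * t * B := by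
    refine ⟨quadV w (rep a + rep b) - quadV w (rep a) - quadV w (rep b), fun s t => ?_⟩
    simp [quadV]
    ring
  obtain ⟨B, hB⟩ := key
  rw [fa, fb] at hB
  obtain ⟨s, t, hst⟩ := rep_comb hrep hab ha hb hc
  have hne : ∀ (x y : Plane F) (r : F), rep x = r • rep y → y = x := by
    intro x y r h
    obtain ⟨hx, hx'⟩ := hrep x
    obtain ⟨hy, hy'⟩ := hrep y
    rw [← hx', ← hy', eq_comm, Projectivization.mk_eq_mk_iff']
    exact ⟨r, h.symm⟩
  have hs : s ≠ 0 := by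
    rintro rfl
    exact hbc (hne c b t (by rw [hst]; simp))
  have ht : t ≠ 0 := by
    rintro rfl
    exact hac (hne c a s (by rw [hst]; simp))
  have hB0 : B = 0 := by
    have := hB s t
    rw [← hst, fc] at this
    simpa [hs, ht] using this.symm
  obtain ⟨s', t', h'⟩ := rep_comb hrep hab ha hb hp
  rw [h', hB, hB0]
  simp

lemma veronese_prod {F : Type*} [Field F] {rep : Plane F → (Fin 3 → F)}
    (hrep : ∀ p : Plane F, ∃ h : rep p ≠ 0, Projectivization.mk F (rep p) h = p)
    (l m : Plane F) :
    ∃ c ∈ VeroneseCode rep, ∀ p, c p = 0 ↔ p ∈ l ∨ p ∈ m := by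
  refine ⟨fun p => (rep p ⬝ᵥ rep l) * (rep p ⬝ᵥ rep m), ?_, fun p => ?_⟩
  · rw [veronese_eq_range]
    set u := rep l
    set v := rep m
    refine ⟨![u 0 * v 0, u 1 * v 1, u 2 * v 2, u 0 * v 1 + u 1 * v 0, u 0 * v 2 + u 2 * v 0,
      u 1 * v 2 + u 2 * v 1], ?_⟩
    ext p
    rw [quadL_apply, quadV]
    simp [dotProduct, Fin.sum_univ_three]
    ring
  · rw [mul_eq_zero, mem_iff_dot hrep, mem_iff_dot hrep]

open Classical in
lemma veronese_geom {F : Type*} [Field F] {rep : Plane F → (Fin 3 → F)}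
    (hrep : ∀ p : Plane F, ∃ h : rep p ≠ 0, Projectivization.mk F (rep p) h = p)
    [Fintype F] [Fintype (Plane F)] (q : ℕ) (hq : Fintype.card F = q)
    (hq4 : 4 ≤ q) :
    VGeom (VeroneseCode rep) (fun l : Plane F => univ.filter fun p : Plane F => p ∈ l) q := by
  have hcard : Fintype.card (Plane F) = q ^ 2 + q + 1 := by
    rw [← Nat.card_eq_fintype_card, Projectivization.card_of_finrank F (Fin 3 → F) (n := 3) (by simp)]
    simp [sum_range_succ, hq]
    ring
  have hord : Configuration.ProjectivePlane.order (Plane F) (Plane F) = q := by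
    have := Configuration.ProjectivePlane.card_points (Plane F) (Plane F)
    rw [hcard] at this
    set n := Configuration.ProjectivePlane.order (Plane F) (Plane F)
    rcases lt_trichotomy n q with h | h | h
    · nlinarith
    · exact h
    · nlinarith
  have hline : ∀ a b : Plane F, a ≠ b → ∃ l : Plane F, a ∈ l ∧ b ∈ l := fun a b h =>
    ⟨Configuration.HasLines.mkLine h, Configuration.HasLines.mkLine_ax h⟩
  have huniq : ∀ a b l m : Plane F, a ≠ b → a ∈ l → b ∈ l → a ∈ m → b ∈ m → l = m :=
    fun a b l m h h1 h2 h3 h4 => (Configuration.Nondegenerate.eq_or_eq h1 h2 h3 h4).resolve_left h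
  refine ⟨hq, hq4, hcard, hcard, ?_, ?_, ?_, ?_, ?_, ?_, ?_⟩
  · intro l
    have := Configuration.ProjectivePlane.pointCount_eq (Plane F) l
    rw [hord] at this
    rw [← this, Configuration.pointCount, Nat.card_eq_fintype_card, Fintype.card_subtype]
  · simpa using hline
  · simpa using huniq
  · intro a b hab
    obtain ⟨l, h1, h2⟩ := hline a b hab
    obtain ⟨e, he⟩ := Configuration.Nondegenerate.exists_point (P := Plane F) l
    obtain ⟨m, h3, h4⟩ := hline a e (by rintro rfl; exact he h1)
    refine ⟨m, by simpa using h3, ?_⟩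
    simp only [mem_filter, mem_univ, true_and]
    intro hb
    exact he (huniq a b l m hab h1 h2 h3 hb ▸ h4)
  · rw [veronese_eq_range, LinearMap.finrank_range_of_inj (quadL_inj hrep)]
    simp
  · simpa using veronese_prod hrep
  · simp only [mem_filter, mem_univ, true_and]
    exact veronese_van hrep

open Classical in
lemma hw_eq {F : Type*} [Field F] [Fintype F] [Fintype (Plane F)] (rep : Plane F → (Fin 3 → F))
    (w n : ℕ) (h : n + w = Fintype.card (Plane F)) :
    hwSpectrum rep 2 w = VGeom.BN (VeroneseCode rep) n := by
  rw [hwSpectrum, VGeom.BN, Nat.subtype_card]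
  intro D
  rw [mem_filter, mem_V2, and_assoc]
  refine and_congr_right fun _ => and_congr_right fun _ => ?_
  have : #(VGeom.Base D) + wtSub D = Fintype.card (Plane F) := by
    have h1 : wtSub D = #(univ.filter fun p => ¬ ∀ c ∈ D, c p = 0) := by
      rw [wtSub]
      apply Nat.subtype_card
      intro p
      simp
    rw [h1, VGeom.Base, card_filter_add_card_filter_not, card_univ]
  omega

open Classical in
lemma hw_zero {F : Type*} [Field F] [Fintype F] [Fintype (Plane F)] (rep : Plane F → (Fin 3 → F))
    (w : ℕ) (h : Fintype.card (Plane F) < w) : hwSpectrum rep 2 w = 0 := by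
  rw [hwSpectrum, Nat.card_eq_zero]
  left
  constructor
  rintro ⟨D, -, -, hD⟩
  have h1 : wtSub D ≤ Fintype.card (Plane F) := by
    rw [wtSub, ← Nat.card_eq_fintype_card]
    exact Finite.card_subtype_le _
  omega

end VG4

theorem veronese_spectrum_dim_two
    {F : Type*} [Field F] [Fintype F] (q : ℕ) (hq : Fintype.card F = q) (hq4 : 4 ≤ q)
    (rep : Plane F → (Fin 3 → F))
    (hrep : ∀ p : Plane F, ∃ h : rep p ≠ 0, Projectivization.mk F (rep p) h = p) :
    (hwSpectrum rep 2 (q ^ 2 - 1) : ℚ) = (q : ℚ) ^ 4 + q ^ 3 + q ^ 2 ∧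
    (hwSpectrum rep 2 (q ^ 2) : ℚ) = (q : ℚ) ^ 3 + 2 * q ^ 2 + 2 * q + 1 ∧
    (hwSpectrum rep 2 (q ^ 2 + q - 3) : ℚ) = ((q : ℚ) ^ 8 - q ^ 6 - q ^ 5 + q ^ 3) / 24 ∧
    (hwSpectrum rep 2 (q ^ 2 + q - 2) : ℚ) = ((q : ℚ) ^ 7 + q ^ 6 - q ^ 4 - q ^ 3) / 2 ∧
    (hwSpectrum rep 2 (q ^ 2 + q - 1) : ℚ) =
      ((q : ℚ) ^ 8 + 5 * q ^ 6 + 7 * q ^ 5 + 4 * q ^ 4 - q ^ 3 - 4 * q ^ 2) / 4 ∧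
    (hwSpectrum rep 2 (q ^ 2 + q) : ℚ) =
      (2 * (q : ℚ) ^ 8 + 3 * q ^ 7 + q ^ 6 + 4 * q ^ 5 + 9 * q ^ 4 + 5 * q ^ 3 - 6 * q) / 6 ∧
    (hwSpectrum rep 2 (q ^ 2 + q + 1) : ℚ) =
      (3 * (q : ℚ) ^ 8 + q ^ 6 - 3 * q ^ 5 - q ^ 3) / 8 ∧
    ∀ w : ℕ, w ∉ ({q ^ 2 - 1, q ^ 2, q ^ 2 + q - 3, q ^ 2 + q - 2, q ^ 2 + q - 1,
        q ^ 2 + q, q ^ 2 + q + 1} : Set ℕ) → hwSpectrum rep 2 w = 0 := by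
  classical
  have : Fintype (Plane F) := Fintype.ofFinite _
  have G := veronese_geom hrep q hq hq4
  have hc := G.cardP
  obtain ⟨h1, h2, h3, h4, h5, h6, h7⟩ := G.solve
  have hqq : 16 ≤ q ^ 2 := by nlinarith
  refine ⟨?_, ?_, ?_, ?_, ?_, ?_, ?_, ?_⟩
  · rw [hw_eq rep _ (q + 2) (by omega), h1]
  · rw [hw_eq rep _ (q + 1) (by omega), h2]
  · rw [hw_eq rep _ 4 (by omega), h3]
  · rw [hw_eq rep _ 3 (by omega), h4]
  · rw [hw_eq rep _ 2 (by omega), h5]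
  · rw [hw_eq rep _ 1 (by omega), h6]
  · rw [hw_eq rep _ 0 (by omega), h7]
  · intro w hw
    simp only [Set.mem_insert_iff, Set.mem_singleton_iff, not_or] at hw
    rcases Nat.lt_or_ge (q ^ 2 + q + 1) w with h | h
    · exact hw_zero rep w (by omega)
    · rw [hw_eq rep w (q ^ 2 + q + 1 - w) (by omega)]
      apply G.BN_zero <;> omega
end
end

section
/- Let q ≥ 4 be a prime power. For the Veronese code C_q, the number of 3-dimensional subcodes of each weight is: A_{q^2}^(3) = q^2+q+1, A_{q^2+q−2}^(3) = (q^6+2q^5+2q^4+q^3)/6, A_{q^2+q−1}^(3) = (q^7+2q^6+3q^5+3q^4+2q^3+q^2)/2, A_{q^2+q}^(3) = (2q^8+2q^7+3q^6+2q^5+4q^4+3q^3+2q^2)/2, A_{q^2+q+1}^(3) = (6q^9+3q^7+2q^6+q^5−5q^4+2q^3−3q^2)/6, and A_w^(3) = 0 for every other weight w. -/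
noncomputable section

open MvPolynomial

/-- A ternary quadratic form given by its six coefficients. -/
def quad {F : Type*} [Field F] (a : Fin 6 → F) (y : Fin 3 → F) : F :=
  a 0 * y 0 ^ 2 + a 1 * y 1 ^ 2 + a 2 * y 2 ^ 2 + a 3 * (y 0 * y 1) + a 4 * (y 0 * y 2)
    + a 5 * (y 1 * y 2)

theorem mem_veronese {F : Type*} [Field F] (rep : Plane F → (Fin 3 → F)) (c : Plane F → F) :
    c ∈ VeroneseCode rep ↔
      ∃ f : MvPolynomial (Fin 3) F, f.IsHomogeneous 2 ∧ ∀ p, aeval (rep p) f = c p := by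
  simp only [VeroneseCode, Submodule.mem_map, mem_homogeneousSubmodule]
  constructor
  · rintro ⟨f, hf, rfl⟩
    exact ⟨f, hf, fun p => rfl⟩
  · rintro ⟨f, hf, h⟩
    exact ⟨f, hf, funext h⟩

theorem monomial_quad {F : Type*} [Field F] (d : Fin 3 →₀ ℕ) (hd : d.degree = 2) (r : F) :
    ∃ a : Fin 6 → F, ∀ y : Fin 3 → F, aeval y (monomial d r) = quad a y := by
  have h : d 0 + d 1 + d 2 = 2 := by
    have := hd
    rwa [Finsupp.degree_eq_sum, Fin.sum_univ_three] at this
  have key : ∀ y : Fin 3 → F, aeval y (monomial d r) =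
      r * (y 0 ^ d 0 * y 1 ^ d 1 * y 2 ^ d 2) := by
    intro y
    rw [aeval_monomial, Finsupp.prod_fintype _ _ (by simp), Fin.prod_univ_three]
    rfl
  have hcases : (d 0 = 2 ∧ d 1 = 0 ∧ d 2 = 0) ∨ (d 0 = 0 ∧ d 1 = 2 ∧ d 2 = 0) ∨
      (d 0 = 0 ∧ d 1 = 0 ∧ d 2 = 2) ∨ (d 0 = 1 ∧ d 1 = 1 ∧ d 2 = 0) ∨
      (d 0 = 1 ∧ d 1 = 0 ∧ d 2 = 1) ∨ (d 0 = 0 ∧ d 1 = 1 ∧ d 2 = 1) := by omega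
  rcases hcases with ⟨h0, h1, h2⟩ | ⟨h0, h1, h2⟩ | ⟨h0, h1, h2⟩ | ⟨h0, h1, h2⟩ | ⟨h0, h1, h2⟩ |
    ⟨h0, h1, h2⟩
  · exact ⟨![r, 0, 0, 0, 0, 0], fun y => by rw [key, h0, h1, h2]; simp [quad]⟩
  · exact ⟨![0, r, 0, 0, 0, 0], fun y => by rw [key, h0, h1, h2]; simp [quad]⟩
  · exact ⟨![0, 0, r, 0, 0, 0], fun y => by rw [key, h0, h1, h2]; simp [quad]⟩
  · exact ⟨![0, 0, 0, r, 0, 0], fun y => by rw [key, h0, h1, h2]; simp [quad]⟩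
  · exact ⟨![0, 0, 0, 0, r, 0], fun y => by rw [key, h0, h1, h2]; simp [quad]⟩
  · exact ⟨![0, 0, 0, 0, 0, r], fun y => by rw [key, h0, h1, h2]; simp [quad]⟩

theorem homog_quad {F : Type*} [Field F] (f : MvPolynomial (Fin 3) F) (hf : f.IsHomogeneous 2) :
    ∃ a : Fin 6 → F, ∀ y : Fin 3 → F, aeval y f = quad a y := by
  have h : ∀ d : Fin 3 →₀ ℕ, ∃ a : Fin 6 → F, ∀ y : Fin 3 → F,
      aeval y (monomial d (coeff d f)) = quad a y := by
    intro d
    by_cases hd : d.degree = 2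
    · exact monomial_quad d hd _
    · rw [hf.coeff_eq_zero hd]
      exact ⟨0, fun y => by simp [quad]⟩
  choose a ha using h
  refine ⟨∑ d ∈ f.support, a d, fun y => ?_⟩
  conv_lhs => rw [f.as_sum]
  rw [map_sum, Finset.sum_congr rfl (fun d _ => ha d y)]
  simp only [quad, Finset.sum_apply, Finset.sum_mul, Finset.sum_add_distrib]

theorem veronese_exists {F : Type*} [Field F] (rep : Plane F → (Fin 3 → F))
    (b : Module.Basis (Fin 3) F (Fin 3 → F)) (c : Plane F → F) (hc : c ∈ VeroneseCode rep) :
    ∃ a, ∀ p, c p = quad a (b.equivFun (rep p)) := by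
  obtain ⟨f, hf, h⟩ := (mem_veronese rep c).1 hc
  let L : Fin 3 → MvPolynomial (Fin 3) F := fun j => ∑ i, C (b i j) * X i
  have hL : ∀ j, (L j).IsHomogeneous 1 := fun j =>
    IsHomogeneous.sum _ _ _ fun i _ => isHomogeneous_C_mul_X _ _
  have hg : (aeval L f).IsHomogeneous 2 := by
    have := hf.aeval L hL
    simpa using this
  obtain ⟨a, ha⟩ := homog_quad _ hg
  refine ⟨a, fun p => ?_⟩
  rw [← h, ← ha, ← AlgHom.comp_apply]
  have : rep p = fun j => aeval (b.equivFun (rep p)) (L j) := by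
    funext j
    conv_lhs => rw [← b.sum_equivFun (rep p)]
    simp [L, Finset.sum_apply, mul_comm]
  rw [comp_aeval]
  conv_lhs => rw [this]


theorem veronese_mem {F : Type*} [Field F] (rep : Plane F → (Fin 3 → F))
    (b : Module.Basis (Fin 3) F (Fin 3 → F)) (a : Fin 6 → F) :
    (fun p => quad a (b.equivFun (rep p))) ∈ VeroneseCode rep := by
  rw [mem_veronese]
  let L : Fin 3 → MvPolynomial (Fin 3) F := fun j => ∑ i, C (b.equivFun (Pi.single i 1) j) * X i
  have hL : ∀ j, (L j).IsHomogeneous 1 := fun j =>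
    IsHomogeneous.sum _ _ _ fun i _ => isHomogeneous_C_mul_X _ _
  have hL2 : ∀ i j (r : F), (C r * (L i * L j)).IsHomogeneous 2 := fun i j r =>
    ((hL i).mul (hL j)).C_mul r
  have hev : ∀ p j, aeval (rep p) (L j) = b.equivFun (rep p) j := by
    intro p j
    conv_rhs => rw [← (Pi.basisFun F (Fin 3)).sum_equivFun (rep p), map_sum]
    simp [L, mul_comm]
  refine ⟨C (a 0) * (L 0 * L 0) + C (a 1) * (L 1 * L 1) + C (a 2) * (L 2 * L 2)
    + C (a 3) * (L 0 * L 1) + C (a 4) * (L 0 * L 2) + C (a 5) * (L 1 * L 2), ?_, ?_⟩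
  · exact ((((((hL2 _ _ _).add (hL2 _ _ _)).add (hL2 _ _ _)).add (hL2 _ _ _)).add
      (hL2 _ _ _)).add (hL2 _ _ _))
  · intro p
    simp only [map_add, map_mul, hev, quad, aeval_C, Algebra.algebraMap_self, RingHom.id_apply]
    ring

theorem quad_smul {F : Type*} [Field F] (a : Fin 6 → F) (u : F) (y : Fin 3 → F) :
    quad a (u • y) = u ^ 2 * quad a y := by
  simp only [quad, Pi.smul_apply, smul_eq_mul]; ring

theorem rep_mk_smul {F : Type*} [Field F] (rep : Plane F → (Fin 3 → F))
    (hrep : ∀ p : Plane F, ∃ h : rep p ≠ 0, Projectivization.mk F (rep p) h = p)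
    (v : Fin 3 → F) (hv : v ≠ 0) :
    ∃ u : F, u ≠ 0 ∧ rep (Projectivization.mk F v hv) = u • v := by
  obtain ⟨h, e⟩ := hrep (Projectivization.mk F v hv)
  rw [Projectivization.mk_eq_mk_iff'] at e
  obtain ⟨u, hu⟩ := e
  refine ⟨u, ?_, hu.symm⟩
  rintro rfl
  exact h (by rw [← hu]; simp)

theorem quad_inj {F : Type*} [Field F] (a : Fin 6 → F) (h : ∀ v, v ≠ 0 → quad a v = 0) :
    a = 0 := by
  have h0 := h ![1, 0, 0] (by intro e; simpa using congrFun e 0)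
  have h1 := h ![0, 1, 0] (by intro e; simpa using congrFun e 1)
  have h2 := h ![0, 0, 1] (by intro e; simpa using congrFun e 2)
  have h3 := h ![1, 1, 0] (by intro e; simpa using congrFun e 0)
  have h4 := h ![1, 0, 1] (by intro e; simpa using congrFun e 0)
  have h5 := h ![0, 1, 1] (by intro e; simpa using congrFun e 1)
  simp [quad] at h0 h1 h2 h3 h4 h5
  simp [h0, h1, h2] at h3 h4 h5
  funext i
  fin_cases i <;> simp [*]

/-- The linear parametrization of the Veronese code by coefficients. -/
def quadMap {F : Type*} [Field F] (rep : Plane F → (Fin 3 → F)) :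
    (Fin 6 → F) →ₗ[F] (Plane F → F) where
  toFun a := fun p => quad a ((Pi.basisFun F (Fin 3)).equivFun (rep p))
  map_add' a b := by funext p; simp only [quad, Pi.add_apply]; ring
  map_smul' r a := by
    funext p; simp only [quad, Pi.smul_apply, smul_eq_mul, RingHom.id_apply]; ring

theorem finrank_veronese {F : Type*} [Field F] (rep : Plane F → (Fin 3 → F))
    (hrep : ∀ p : Plane F, ∃ h : rep p ≠ 0, Projectivization.mk F (rep p) h = p) :
    Module.finrank F (VeroneseCode rep) = 6 := by
  have h1 : LinearMap.range (quadMap rep) = VeroneseCode rep := by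
    apply le_antisymm
    · rintro _ ⟨a, rfl⟩
      exact veronese_mem rep _ a
    · intro c hc
      obtain ⟨a, ha⟩ := veronese_exists rep (Pi.basisFun F (Fin 3)) c hc
      exact ⟨a, (funext ha).symm⟩
  have h2 : Function.Injective (quadMap rep) := by
    rw [← LinearMap.ker_eq_bot, LinearMap.ker_eq_bot']
    intro a ha
    apply quad_inj
    intro v hv
    obtain ⟨u, hu, e⟩ := rep_mk_smul rep hrep v hv
    have := congrFun ha (Projectivization.mk F v hv)
    simp only [quadMap, LinearMap.coe_mk, AddHom.coe_mk, e, map_smul, quad_smul, Pi.zero_apply,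
      mul_eq_zero] at this
    rcases this with h | h
    · exact absurd (pow_eq_zero_iff (by norm_num) |>.1 h) hu
    · have e : (Pi.basisFun F (Fin 3)).equivFun v = v := by ext; simp
      rwa [e] at h
  rw [← h1, LinearMap.finrank_range_of_inj h2]
  simp

/-- Counting three-dimensional subspaces of a subspace `W`. -/
theorem count_subspaces {F E : Type*} [Field F] [Fintype F] [AddCommGroup E] [Module F E]
    [Finite E] (W : Submodule F E) (hW : 3 ≤ Module.finrank F W) :
    Nat.card {D : Submodule F E // D ≤ W ∧ Module.finrank F D = 3} *
      ∏ i : Fin 3, (Fintype.card F ^ 3 - Fintype.card F ^ i.val) =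
      ∏ i : Fin 3, (Fintype.card F ^ Module.finrank F W - Fintype.card F ^ i.val) := by
  classical
  rw [← card_linearIndependent hW]
  let f : {s : Fin 3 → W // LinearIndependent F s} →
      {D : Submodule F E // D ≤ W ∧ Module.finrank F D = 3} := fun s =>
    ⟨Submodule.span F (Set.range fun i => (s.1 i : E)), by
      constructor
      · rw [Submodule.span_le]
        rintro _ ⟨i, rfl⟩
        exact (s.1 i).2
      · have : LinearIndependent F (fun i => (s.1 i : E)) :=
          s.2.map' W.subtype (Submodule.ker_subtype W)
        rw [finrank_span_eq_card this]
        simp⟩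
  have hfib : ∀ D, Nat.card {s // f s = D} =
      ∏ i : Fin 3, (Fintype.card F ^ 3 - Fintype.card F ^ i.val) := by
    intro D
    have e : {s // f s = D} ≃ {t : Fin 3 → D.1 // LinearIndependent F t} :=
      { toFun := fun s => ⟨fun i => ⟨s.1.1 i, by
          have : (s.1.1 i : E) ∈ (f s.1).1 := Submodule.subset_span ⟨i, rfl⟩
          rw [s.2] at this; exact this⟩, by
          apply LinearIndependent.of_comp D.1.subtype
          exact s.1.2.map' W.subtype (Submodule.ker_subtype W)⟩
        invFun := fun t => ⟨⟨fun i => ⟨t.1 i, D.2.1 (t.1 i).2⟩, by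
          apply LinearIndependent.of_comp W.subtype
          exact t.2.map' D.1.subtype (Submodule.ker_subtype D.1)⟩, by
          apply Subtype.ext
          have hli : LinearIndependent F (fun i => (t.1 i : E)) :=
            t.2.map' D.1.subtype (Submodule.ker_subtype D.1)
          apply Submodule.eq_of_le_of_finrank_eq
          · rw [Submodule.span_le]
            rintro _ ⟨i, rfl⟩
            exact (t.1 i).2
          · refine Eq.trans ?_ D.2.2.symm
            change Module.finrank F (Submodule.span F (Set.range fun i => (t.1 i : E))) = 3
            rw [finrank_span_eq_card hli]
            simp⟩
        left_inv := fun s => rfl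
        right_inv := fun t => rfl }
    rw [Nat.card_congr e, card_linearIndependent (by rw [D.2.2]), D.2.2]
  rw [← Nat.card_congr (Equiv.sigmaFiberEquiv f)]
  have : Finite {D : Submodule F E // D ≤ W ∧ Module.finrank F D = 3} := inferInstance
  have := Fintype.ofFinite {D : Submodule F E // D ≤ W ∧ Module.finrank F D = 3}
  rw [Nat.card_sigma, Finset.sum_congr rfl (fun D _ => hfib D)]
  simp

theorem card_emb_into {P : Type*} [Fintype P] [DecidableEq P] (S : Finset P) (k : ℕ) :
    (Finset.univ.filter fun f : Fin k ↪ P => ∀ i, f i ∈ S).card = S.card.descFactorial k := by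
  have e : {f : Fin k ↪ P // ∀ i, f i ∈ S} ≃ (Fin k ↪ S) :=
    { toFun := fun f => ⟨fun i => ⟨f.1 i, f.2 i⟩, fun i j h => f.1.injective (by simpa using h)⟩
      invFun := fun g => ⟨⟨fun i => (g i : P), fun i j h => g.injective (Subtype.ext h)⟩,
        fun i => (g i).2⟩
      left_inv := fun f => rfl
      right_inv := fun g => rfl }
  rw [← Fintype.card_subtype, Fintype.card_congr e, Fintype.card_embedding_eq]
  simp

theorem double_count {P ι : Type*} [Fintype P] [DecidableEq P] (X : Finset ι) (B : ι → Finset P)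
    (k m : ℕ) (h : ∀ f : Fin k ↪ P, (X.filter fun D => ∀ i, f i ∈ B D).card = m) :
    ∑ D ∈ X, (B D).card.descFactorial k = (Fintype.card P).descFactorial k * m := by
  rw [Finset.sum_congr rfl (fun D _ => (card_emb_into (B D) k).symm)]
  have := Finset.sum_card_bipartiteAbove_eq_sum_card_bipartiteBelow (s := X)
    (t := (Finset.univ : Finset (Fin k ↪ P))) (fun D f => ∀ i, f i ∈ B D)
  simp only [Finset.bipartiteAbove, Finset.bipartiteBelow] at this
  rw [this, Finset.sum_congr rfl (fun f _ => h f)]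
  simp [Fintype.card_embedding_eq]

theorem rep_eq {F : Type*} [Field F] (rep : Plane F → (Fin 3 → F))
    (hrep : ∀ p : Plane F, ∃ h : rep p ≠ 0, Projectivization.mk F (rep p) h = p)
    (p p' : Plane F) (u : F) (h : rep p = u • rep p') : p = p' := by
  obtain ⟨h1, e1⟩ := hrep p
  obtain ⟨h2, e2⟩ := hrep p'
  rw [← e1, ← e2, Projectivization.mk_eq_mk_iff']
  exact ⟨u, h.symm⟩

theorem rep_pair {F : Type*} [Field F] (rep : Plane F → (Fin 3 → F))
    (hrep : ∀ p : Plane F, ∃ h : rep p ≠ 0, Projectivization.mk F (rep p) h = p)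
    (p p' : Plane F) (h : p ≠ p') : LinearIndependent F ![rep p, rep p'] := by
  rw [LinearIndependent.pair_iff' (hrep p).1]
  intro a ha
  exact h (rep_eq rep hrep p' p a ha.symm).symm

theorem basis_of_notMem {F : Type*} [Field F] (x y z : Fin 3 → F)
    (h : LinearIndependent F ![x, y]) (hz : z ∉ Submodule.span F (Set.range ![x, y])) :
    ∃ b : Module.Basis (Fin 3) F (Fin 3 → F), b 0 = z ∧ b 1 = x ∧ b 2 = y := by
  have hli : LinearIndependent F ![z, x, y] := by
    have := linearIndependent_finCons.2 ⟨h, hz⟩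
    exact this
  refine ⟨basisOfLinearIndependentOfCardEqFinrank hli (by simp), ?_, ?_, ?_⟩ <;> simp

theorem basis_extend {F : Type*} [Field F] (x y : Fin 3 → F)
    (h : LinearIndependent F ![x, y]) :
    ∃ b : Module.Basis (Fin 3) F (Fin 3 → F), b 1 = x ∧ b 2 = y := by
  obtain ⟨z, hz⟩ := exists_linearIndependent_cons_of_lt_finrank h (by simp)
  obtain ⟨b, -, h1, h2⟩ := basis_of_notMem x y z h (linearIndependent_finCons.1 hz).2
  exact ⟨b, h1, h2⟩

theorem dichotomy {F : Type*} [Field F] (rep : Plane F → (Fin 3 → F))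
    (hrep : ∀ p : Plane F, ∃ h : rep p ≠ 0, Projectivization.mk F (rep p) h = p)
    (p1 p2 p3 : Plane F) (h12 : p1 ≠ p2) (h13 : p3 ≠ p1) (h23 : p3 ≠ p2) :
    (∃ b : Module.Basis (Fin 3) F (Fin 3 → F), b 0 = rep p3 ∧ b 1 = rep p1 ∧ b 2 = rep p2) ∨
    (∃ s t : F, s ≠ 0 ∧ t ≠ 0 ∧ rep p3 = s • rep p1 + t • rep p2) := by
  by_cases hz : rep p3 ∈ Submodule.span F (Set.range ![rep p1, rep p2])
  · right
    simp only [Matrix.range_cons, Matrix.range_empty, Set.union_empty, Set.singleton_union] at hz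
    obtain ⟨s, t, e⟩ := Submodule.mem_span_pair.1 hz
    refine ⟨s, t, ?_, ?_, e.symm⟩
    · rintro rfl
      exact h23 (rep_eq rep hrep _ _ t (by rw [← e]; simp))
    · rintro rfl
      exact h13 (rep_eq rep hrep _ _ s (by rw [← e]; simp))
  · left
    exact basis_of_notMem _ _ _ (rep_pair rep hrep p1 p2 h12) hz

theorem quad_basis {F : Type*} [Field F] (b : Module.Basis (Fin 3) F (Fin 3 → F))
    (a : Fin 6 → F) :
    quad a (b.equivFun (b 0)) = a 0 ∧ quad a (b.equivFun (b 1)) = a 1 ∧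
    quad a (b.equivFun (b 2)) = a 2 ∧ (∀ s t : F, quad a (b.equivFun (s • b 1 + t • b 2)) =
      s ^ 2 * a 1 + t ^ 2 * a 2 + s * t * a 5) := by
  refine ⟨?_, ?_, ?_, ?_⟩
  · simp [quad]
  · simp [quad]
  · simp [quad]
  · intro s t
    simp [quad]
    ring

theorem surj_three {F : Type*} [Field F] (rep : Plane F → (Fin 3 → F))
    (hrep : ∀ p : Plane F, ∃ h : rep p ≠ 0, Projectivization.mk F (rep p) h = p)
    (p1 p2 p3 : Plane F) (h12 : p1 ≠ p2) (h13 : p3 ≠ p1) (h23 : p3 ≠ p2) (v1 v2 v3 : F) :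
    ∃ c ∈ VeroneseCode rep, c p1 = v1 ∧ c p2 = v2 ∧ c p3 = v3 := by
  rcases dichotomy rep hrep p1 p2 p3 h12 h13 h23 with ⟨b, h0, h1, h2⟩ | ⟨s, t, hs, ht, e⟩
  · refine ⟨_, veronese_mem rep b ![v3, v1, v2, 0, 0, 0], ?_, ?_, ?_⟩
    · rw [← h1, (quad_basis b _).2.1]; simp
    · rw [← h2, (quad_basis b _).2.2.1]; simp
    · rw [← h0, (quad_basis b _).1]; simp
  · obtain ⟨b, h1, h2⟩ := basis_extend _ _ (rep_pair rep hrep p1 p2 h12)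
    refine ⟨_, veronese_mem rep b ![0, v1, v2, 0, 0, (v3 - s ^ 2 * v1 - t ^ 2 * v2) / (s * t)],
      ?_, ?_, ?_⟩
    · rw [← h1, (quad_basis b _).2.1]; simp
    · rw [← h2, (quad_basis b _).2.2.1]; simp
    · rw [e, ← h1, ← h2, (quad_basis b _).2.2.2]
      simp
      field_simp
      ring

theorem exists_third_s3 {F : Type*} [Field F] [Fintype F] (p1 p2 : Plane F) :
    ∃ p3 : Plane F, p3 ≠ p1 ∧ p3 ≠ p2 := by
  classical
  by_contra! hcon
  have hc : Nat.card (Plane F) = ∑ i ∈ Finset.range 3, Nat.card F ^ i :=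
    Projectivization.card_of_finrank F _ (by simp)
  have := Fintype.ofFinite (Plane F)
  have hle : Fintype.card (Plane F) ≤ 2 := by
    have : (Finset.univ : Finset (Plane F)) ⊆ {p1, p2} := by
      intro p _
      by_cases h : p = p1
      · simp [h]
      · simp [hcon p h]
    exact (Finset.card_le_card this).trans Finset.card_le_two
  have h1 : 1 < Nat.card F := Finite.one_lt_card
  rw [← Nat.card_eq_fintype_card, hc] at hle
  simp [Finset.sum_range_succ] at hle
  nlinarith [Nat.card_eq_fintype_card (α := F)]

theorem surj_k {F : Type*} [Field F] [Fintype F] (rep : Plane F → (Fin 3 → F))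
    (hrep : ∀ p : Plane F, ∃ h : rep p ≠ 0, Projectivization.mk F (rep p) h = p)
    (k : ℕ) (hk : k ≤ 3) (f : Fin k ↪ Plane F) (v : Fin k → F) :
    ∃ c ∈ VeroneseCode rep, ∀ i, c (f i) = v i := by
  interval_cases k
  · exact ⟨0, Submodule.zero_mem _, fun i => i.elim0⟩
  · obtain ⟨p2, h2, -⟩ := exists_third_s3 (f 0) (f 0)
    obtain ⟨p3, h31, h32⟩ := exists_third_s3 (f 0) p2
    obtain ⟨c, hc, h, -⟩ := surj_three rep hrep (f 0) p2 p3 h2.symm h31 h32 (v 0) 0 0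
    refine ⟨c, hc, fun i => ?_⟩
    fin_cases i
    exact h
  · obtain ⟨p3, h31, h32⟩ := exists_third_s3 (f 0) (f 1)
    obtain ⟨c, hc, h, hb, -⟩ := surj_three rep hrep (f 0) (f 1) p3
      (f.injective.ne (by decide)) h31 h32 (v 0) (v 1) 0
    refine ⟨c, hc, fun i => ?_⟩
    fin_cases i
    · exact h
    · exact hb
  · obtain ⟨c, hc, h, hb, hd⟩ := surj_three rep hrep (f 0) (f 1) (f 2)
      (f.injective.ne (by decide)) (f.injective.ne (by decide)) (f.injective.ne (by decide))
      (v 0) (v 1) (v 2)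
    refine ⟨c, hc, fun i => ?_⟩
    fin_cases i
    · exact h
    · exact hb
    · exact hd

/-- Codewords vanishing at the given points. -/
def vanishAt {F : Type*} [Field F] (rep : Plane F → (Fin 3 → F)) {k : ℕ} (f : Fin k → Plane F) :
    Submodule F (Plane F → F) :=
  (LinearMap.ker ((LinearMap.funLeft F F f).comp (VeroneseCode rep).subtype)).map
    (VeroneseCode rep).subtype

theorem mem_vanishAt {F : Type*} [Field F] (rep : Plane F → (Fin 3 → F)) {k : ℕ}
    (f : Fin k → Plane F) (c : Plane F → F) :
    c ∈ vanishAt rep f ↔ c ∈ VeroneseCode rep ∧ ∀ i, c (f i) = 0 := by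
  simp only [vanishAt, Submodule.mem_map, LinearMap.mem_ker]
  constructor
  · rintro ⟨c, hc, rfl⟩
    exact ⟨c.2, fun i => congrFun hc i⟩
  · rintro ⟨hc, h⟩
    exact ⟨⟨c, hc⟩, funext h, rfl⟩

theorem finrank_vanishAt {F : Type*} [Field F] [Fintype F] (rep : Plane F → (Fin 3 → F))
    (hrep : ∀ p : Plane F, ∃ h : rep p ≠ 0, Projectivization.mk F (rep p) h = p)
    (k : ℕ) (hk : k ≤ 3) (f : Fin k ↪ Plane F) :
    Module.finrank F (vanishAt rep f) = 6 - k := by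
  rw [vanishAt, Submodule.finrank_map_subtype_eq]
  set g := (LinearMap.funLeft F F f).comp (VeroneseCode rep).subtype
  have h1 := LinearMap.finrank_range_add_finrank_ker g
  have h2 : LinearMap.range g = ⊤ := by
    rw [LinearMap.range_eq_top]
    intro v
    obtain ⟨c, hc, h⟩ := surj_k rep hrep k hk f v
    exact ⟨⟨c, hc⟩, funext h⟩
  rw [h2, finrank_veronese rep hrep] at h1
  simp at h1
  omega

theorem inj_three {P : Type*} (p1 p2 p3 : P) (h12 : p1 ≠ p2) (h13 : p3 ≠ p1) (h23 : p3 ≠ p2) :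
    Function.Injective ![p1, p2, p3] := by
  intro i j hij
  fin_cases i <;> fin_cases j <;> simp_all

/-- The base locus of a subcode. -/
def baseSet {F : Type*} [Field F] (D : Submodule F (Plane F → F)) : Set (Plane F) :=
  {p | ∀ c ∈ D, c p = 0}

theorem mem_of_three {F : Type*} [Field F] [Fintype F] (rep : Plane F → (Fin 3 → F))
    (hrep : ∀ p : Plane F, ∃ h : rep p ≠ 0, Projectivization.mk F (rep p) h = p)
    (D : Submodule F (Plane F → F)) (hD : D ≤ VeroneseCode rep) (hD3 : Module.finrank F D = 3)
    (p1 p2 p3 : Plane F) (h12 : p1 ≠ p2) (h13 : p3 ≠ p1) (h23 : p3 ≠ p2)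
    (h1 : p1 ∈ baseSet D) (h2 : p2 ∈ baseSet D) (h3 : p3 ∈ baseSet D) (c : Plane F → F) :
    c ∈ D ↔ c ∈ VeroneseCode rep ∧ c p1 = 0 ∧ c p2 = 0 ∧ c p3 = 0 := by
  have hinj : Function.Injective ![p1, p2, p3] := by
    exact inj_three _ _ _ h12 h13 h23
  let f : Fin 3 ↪ Plane F := ⟨![p1, p2, p3], hinj⟩
  have hle : D ≤ vanishAt rep f := by
    intro c hc
    rw [mem_vanishAt]
    refine ⟨hD hc, fun i => ?_⟩
    fin_cases i
    · exact h1 c hc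
    · exact h2 c hc
    · exact h3 c hc
  have heq : D = vanishAt rep f := by
    apply Submodule.eq_of_le_of_finrank_eq hle
    rw [hD3, finrank_vanishAt rep hrep 3 le_rfl f]
  rw [heq, mem_vanishAt]
  simp [Fin.forall_fin_succ, f]

theorem base_noncoll {F : Type*} [Field F] [Fintype F] (rep : Plane F → (Fin 3 → F))
    (hrep : ∀ p : Plane F, ∃ h : rep p ≠ 0, Projectivization.mk F (rep p) h = p)
    (D : Submodule F (Plane F → F)) (hD : D ≤ VeroneseCode rep) (hD3 : Module.finrank F D = 3)
    (p1 p2 p3 : Plane F) (h12 : p1 ≠ p2) (h13 : p3 ≠ p1) (h23 : p3 ≠ p2)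
    (h1 : p1 ∈ baseSet D) (h2 : p2 ∈ baseSet D) (h3 : p3 ∈ baseSet D)
    (b : Module.Basis (Fin 3) F (Fin 3 → F)) (b0 : b 0 = rep p3) (b1 : b 1 = rep p1)
    (b2 : b 2 = rep p2) : (baseSet D).ncard = 3 := by
  have key : ∀ a : Fin 6 → F, a 0 = 0 → a 1 = 0 → a 2 = 0 →
      (fun p => quad a (b.equivFun (rep p))) ∈ D := by
    intro a a0 a1 a2
    rw [mem_of_three rep hrep D hD hD3 p1 p2 p3 h12 h13 h23 h1 h2 h3]
    refine ⟨veronese_mem rep b a, ?_, ?_, ?_⟩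
    · rw [← b1, (quad_basis b a).2.1, a1]
    · rw [← b2, (quad_basis b a).2.2.1, a2]
    · rw [← b0, (quad_basis b a).1, a0]
  have heq : baseSet D = {p1, p2, p3} := by
    apply Set.Subset.antisymm
    · intro p hp
      have e3 := hp _ (key ![0, 0, 0, 1, 0, 0] rfl rfl rfl)
      have e4 := hp _ (key ![0, 0, 0, 0, 1, 0] rfl rfl rfl)
      have e5 := hp _ (key ![0, 0, 0, 0, 0, 1] rfl rfl rfl)
      have hsum := b.sum_equivFun (rep p)
      rw [Fin.sum_univ_three, b0, b1, b2] at hsum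
      generalize b.equivFun (rep p) = y at *
      simp [quad] at e3 e4 e5
      have hz : (y 0 = 0 ∧ y 1 = 0) ∨ (y 0 = 0 ∧ y 2 = 0) ∨ (y 1 = 0 ∧ y 2 = 0) := by tauto
      rcases hz with ⟨z, z'⟩ | ⟨z, z'⟩ | ⟨z, z'⟩
      · have := rep_eq rep hrep p p2 (y 2) (by rw [← hsum, z, z']; simp)
        simp [this]
      · have := rep_eq rep hrep p p1 (y 1) (by rw [← hsum, z, z']; simp)
        simp [this]
      · have := rep_eq rep hrep p p3 (y 0) (by rw [← hsum, z, z']; simp)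
        simp [this]
    · rintro p (rfl | rfl | rfl)
      · exact h1
      · exact h2
      · exact h3
  rw [heq]
  exact Set.ncard_eq_three.2 ⟨p1, p2, p3, h12, h13.symm, h23.symm, rfl⟩

theorem base_coll {F : Type*} [Field F] [Fintype F] (rep : Plane F → (Fin 3 → F))
    (hrep : ∀ p : Plane F, ∃ h : rep p ≠ 0, Projectivization.mk F (rep p) h = p)
    (D : Submodule F (Plane F → F)) (hD : D ≤ VeroneseCode rep) (hD3 : Module.finrank F D = 3)
    (p1 p2 p3 : Plane F) (h12 : p1 ≠ p2) (h13 : p3 ≠ p1) (h23 : p3 ≠ p2)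
    (h1 : p1 ∈ baseSet D) (h2 : p2 ∈ baseSet D) (h3 : p3 ∈ baseSet D)
    (s t : F) (hs : s ≠ 0) (ht : t ≠ 0) (e : rep p3 = s • rep p1 + t • rep p2)
    (b : Module.Basis (Fin 3) F (Fin 3 → F)) (b1 : b 1 = rep p1)
    (b2 : b 2 = rep p2) (c : Plane F → F) :
    c ∈ D ↔ ∃ a : Fin 6 → F, a 1 = 0 ∧ a 2 = 0 ∧ a 5 = 0 ∧
      c = fun p => quad a (b.equivFun (rep p)) := by
  rw [mem_of_three rep hrep D hD hD3 p1 p2 p3 h12 h13 h23 h1 h2 h3]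
  constructor
  · rintro ⟨hc, c1, c2, c3⟩
    obtain ⟨a, ha⟩ := veronese_exists rep b c hc
    rw [ha, ← b1, (quad_basis b a).2.1] at c1
    rw [ha, ← b2, (quad_basis b a).2.2.1] at c2
    rw [ha, e, ← b1, ← b2, (quad_basis b a).2.2.2, c1, c2] at c3
    refine ⟨a, c1, c2, ?_, funext ha⟩
    simpa [hs, ht] using c3
  · rintro ⟨a, a1, a2, a5, rfl⟩
    refine ⟨veronese_mem rep b a, ?_, ?_, ?_⟩ <;> beta_reduce
    · rw [← b1, (quad_basis b a).2.1, a1]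
    · rw [← b2, (quad_basis b a).2.2.1, a2]
    · rw [e, ← b1, ← b2, (quad_basis b a).2.2.2, a1, a2, a5]; simp

theorem card_line {F : Type*} [Field F] [Fintype F] (rep : Plane F → (Fin 3 → F))
    (hrep : ∀ p : Plane F, ∃ h : rep p ≠ 0, Projectivization.mk F (rep p) h = p)
    (b : Module.Basis (Fin 3) F (Fin 3 → F)) :
    {p : Plane F | b.equivFun (rep p) 0 = 0}.ncard = Fintype.card F + 1 := by
  let H := LinearMap.ker (b.coord 0)
  have hH : Module.finrank F H = 2 := by
    have hne : b.coord 0 ≠ 0 := by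
      intro h
      have := congrArg (fun l => l (b 0)) h
      simp at this
    have := Module.Dual.finrank_ker_add_one_of_ne_zero hne
    rw [Module.finrank_fin_fun] at this
    change Module.finrank F (LinearMap.ker (b.coord 0)) = 2
    omega
  have hinj := Projectivization.map_injective H.subtype H.injective_subtype
  have hset : {p : Plane F | b.equivFun (rep p) 0 = 0} =
      Set.range (Projectivization.map H.subtype H.injective_subtype) := by
    ext p
    constructor
    · intro hp
      obtain ⟨h, e⟩ := hrep p
      have hm : rep p ∈ H := by
        simpa [H] using hp
      refine ⟨Projectivization.mk F ⟨rep p, hm⟩ (fun h0 => h (congrArg Subtype.val h0)), ?_⟩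
      rw [Projectivization.map_mk]
      exact e
    · rintro ⟨x, rfl⟩
      induction x using Projectivization.ind with
      | h v hv =>
        rw [Projectivization.map_mk]
        obtain ⟨u, hu, e⟩ := rep_mk_smul rep hrep (H.subtype v)
          (fun h0 => hv (Subtype.ext h0))
        have hv2 : b.repr v.1 0 = 0 := v.2
        change b.equivFun (rep _) 0 = 0
        rw [e, map_smul]
        simp [hv2]
  rw [hset, ← Nat.card_coe_set_eq, Nat.card_range_of_injective hinj,
    Projectivization.card_of_finrank_two F H hH, Nat.card_eq_fintype_card]

theorem base_line {F : Type*} [Field F] [Fintype F] (rep : Plane F → (Fin 3 → F))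
    (hrep : ∀ p : Plane F, ∃ h : rep p ≠ 0, Projectivization.mk F (rep p) h = p)
    (D : Submodule F (Plane F → F)) (b : Module.Basis (Fin 3) F (Fin 3 → F))
    (h : ∀ c, c ∈ D ↔ ∃ a : Fin 6 → F, a 1 = 0 ∧ a 2 = 0 ∧ a 5 = 0 ∧
      c = fun p => quad a (b.equivFun (rep p))) :
    (baseSet D).ncard = Fintype.card F + 1 := by
  rw [← card_line rep hrep b]
  congr 1
  ext p
  constructor
  · intro hp
    have := hp _ ((h _).2 ⟨![1, 0, 0, 0, 0, 0], rfl, rfl, rfl, rfl⟩)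
    simp only [quad] at this
    simpa using this
  · intro hp c hc
    obtain ⟨a, a1, a2, a5, rfl⟩ := (h c).1 hc
    change b.equivFun (rep p) 0 = 0 at hp
    simp only [quad, a1, a2, a5, hp]
    ring

theorem line_exists {F : Type*} [Field F] [Fintype F] (rep : Plane F → (Fin 3 → F))
    (hrep : ∀ p : Plane F, ∃ h : rep p ≠ 0, Projectivization.mk F (rep p) h = p)
    (p1 p2 : Plane F) (h12 : p1 ≠ p2) :
    ∃ D0 : Submodule F (Plane F → F), D0 ≤ VeroneseCode rep ∧ Module.finrank F D0 = 3 ∧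
      p1 ∈ baseSet D0 ∧ p2 ∈ baseSet D0 ∧ (baseSet D0).ncard = Fintype.card F + 1 ∧
      ∀ D : Submodule F (Plane F → F), D ≤ VeroneseCode rep → Module.finrank F D = 3 →
        p1 ∈ baseSet D → p2 ∈ baseSet D → ∀ p3 ∈ baseSet D, p3 ≠ p1 → p3 ≠ p2 →
        D = D0 ∨ (baseSet D).ncard = 3 := by
  have hli := rep_pair rep hrep p1 p2 h12
  obtain ⟨b, b1, b2⟩ := basis_extend _ _ hli
  rw [LinearIndependent.pair_iff] at hli
  have hv : rep p1 + rep p2 ≠ 0 := by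
    intro h
    simpa using hli 1 1 (by simpa using h)
  obtain ⟨u, hu, e⟩ := rep_mk_smul rep hrep _ hv
  set p0 := Projectivization.mk F _ hv
  rw [smul_add] at e
  have h01 : p0 ≠ p1 := by
    intro h
    rw [h] at e
    exact hu (hli (u - 1) u (by
      rw [sub_smul, one_smul, sub_add_eq_add_sub, ← e, sub_self])).2
  have h02 : p0 ≠ p2 := by
    intro h
    rw [h] at e
    exact hu (hli u (u - 1) (by
      rw [sub_smul, one_smul, ← add_sub_assoc, ← e, sub_self])).1
  have hinj : Function.Injective ![p1, p2, p0] := by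
    exact inj_three _ _ _ h12 h01 h02
  let f : Fin 3 ↪ Plane F := ⟨![p1, p2, p0], hinj⟩
  have hD0 : vanishAt rep f ≤ VeroneseCode rep := fun c hc => ((mem_vanishAt rep f c).1 hc).1
  have hD3 : Module.finrank F (vanishAt rep f) = 3 := finrank_vanishAt rep hrep 3 le_rfl f
  have m1 : p1 ∈ baseSet (vanishAt rep f) := fun c hc => ((mem_vanishAt rep f c).1 hc).2 0
  have m2 : p2 ∈ baseSet (vanishAt rep f) := fun c hc => ((mem_vanishAt rep f c).1 hc).2 1
  have m0 : p0 ∈ baseSet (vanishAt rep f) := fun c hc => ((mem_vanishAt rep f c).1 hc).2 2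
  have hmem := base_coll rep hrep _ hD0 hD3 p1 p2 p0 h12 h01 h02 m1 m2 m0 u u hu hu e b b1 b2
  refine ⟨vanishAt rep f, hD0, hD3, m1, m2, base_line rep hrep _ b hmem, ?_⟩
  intro D hD hDr n1 n2 p3 n3 h31 h32
  rcases dichotomy rep hrep p1 p2 p3 h12 h31 h32 with ⟨b', b0', b1', b2'⟩ | ⟨s, t, hs, ht, e'⟩
  · right
    exact base_noncoll rep hrep D hD hDr p1 p2 p3 h12 h31 h32 n1 n2 n3 b' b0' b1' b2'
  · left
    have hmem' := base_coll rep hrep _ hD hDr p1 p2 p3 h12 h31 h32 n1 n2 n3 s t hs ht e' b b1 b2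
    ext c
    rw [hmem, hmem']

theorem sum_by_values {ι : Type*} (X : Finset ι) (β : ι → ℕ) (q : ℕ) (hq : 4 ≤ q)
    (h : ∀ D ∈ X, β D = 0 ∨ β D = 1 ∨ β D = 2 ∨ β D = 3 ∨ β D = q + 1) (g : ℕ → ℕ) :
    ∑ D ∈ X, g (β D) = (X.filter fun D => β D = 0).card * g 0
      + (X.filter fun D => β D = 1).card * g 1 + (X.filter fun D => β D = 2).card * g 2
      + (X.filter fun D => β D = 3).card * g 3
      + (X.filter fun D => β D = q + 1).card * g (q + 1) := by
  have hm : ∀ D ∈ X, β D ∈ ({0, 1, 2, 3, q + 1} : Finset ℕ) := by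
    intro D hD
    simpa using h D hD
  rw [← Finset.sum_fiberwise_of_maps_to hm]
  have hf : ∀ j, ∑ D ∈ X.filter (fun D => β D = j), g (β D) =
      (X.filter fun D => β D = j).card * g j := by
    intro j
    rw [Finset.sum_congr rfl (fun D hD => by rw [(Finset.mem_filter.1 hD).2]), Finset.sum_const,
      smul_eq_mul]
  rw [Finset.sum_congr rfl (fun j _ => hf j)]
  rw [Finset.sum_insert (by simp), Finset.sum_insert (by simp; omega),
    Finset.sum_insert (by simp; omega), Finset.sum_insert (by simp; omega), Finset.sum_singleton]
  ring

theorem gauss_solve (q G d : ℕ) (hq : 4 ≤ q) (hd : 3 ≤ d)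
    (h : G * ∏ i : Fin 3, (q ^ 3 - q ^ i.val) = ∏ i : Fin 3, (q ^ d - q ^ i.val)) :
    (G : ℚ) * (((q : ℚ) ^ 3 - 1) * (q ^ 3 - q) * (q ^ 3 - q ^ 2)) =
      ((q : ℚ) ^ d - 1) * (q ^ d - q) * (q ^ d - q ^ 2) := by
  have hle : ∀ i j : ℕ, i ≤ j → q ^ i ≤ q ^ j := fun i j hij => Nat.pow_le_pow_right (by omega) hij
  have := congrArg (fun n : ℕ => (n : ℚ)) h
  simp only [Fin.prod_univ_three] at this
  push_cast [Nat.cast_sub (hle 0 3 (by omega)), Nat.cast_sub (hle 1 3 (by omega)),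
    Nat.cast_sub (hle 2 3 (by omega)), Nat.cast_sub (hle 0 d (by omega)),
    Nat.cast_sub (hle 1 d (by omega)), Nat.cast_sub (hle 2 d (by omega)), Fin.val_zero,
    Fin.val_one, Fin.val_two] at this
  simpa using this

theorem solve_system (q N0 N1 N2 N3 NL G6 G5 G4 n : ℚ) (hq : 4 ≤ q) (hn : n = q ^ 2 + q + 1)
    (h6 : G6 * ((q ^ 3 - 1) * (q ^ 3 - q) * (q ^ 3 - q ^ 2)) =
      (q ^ 6 - 1) * (q ^ 6 - q) * (q ^ 6 - q ^ 2))
    (h5 : G5 * ((q ^ 3 - 1) * (q ^ 3 - q) * (q ^ 3 - q ^ 2)) =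
      (q ^ 5 - 1) * (q ^ 5 - q) * (q ^ 5 - q ^ 2))
    (h4 : G4 * ((q ^ 3 - 1) * (q ^ 3 - q) * (q ^ 3 - q ^ 2)) =
      (q ^ 4 - 1) * (q ^ 4 - q) * (q ^ 4 - q ^ 2))
    (e0 : N0 + N1 + N2 + N3 + NL = G6)
    (e1 : N1 + 2 * N2 + 3 * N3 + (q + 1) * NL = n * G5)
    (e2 : 2 * N2 + 6 * N3 + (q + 1) * q * NL = n * (n - 1) * G4)
    (e3 : 6 * N3 + (q + 1) * q * (q - 1) * NL = n * (n - 1) * (n - 2))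
    (eL : (q + 1) * q * NL = n * (n - 1)) :
    NL = q ^ 2 + q + 1 ∧ N3 = (q ^ 6 + 2 * q ^ 5 + 2 * q ^ 4 + q ^ 3) / 6 ∧
    N2 = (q ^ 7 + 2 * q ^ 6 + 3 * q ^ 5 + 3 * q ^ 4 + 2 * q ^ 3 + q ^ 2) / 2 ∧
    N1 = (2 * q ^ 8 + 2 * q ^ 7 + 3 * q ^ 6 + 2 * q ^ 5 + 4 * q ^ 4 + 3 * q ^ 3 + 2 * q ^ 2) / 2 ∧
    N0 = (6 * q ^ 9 + 3 * q ^ 7 + 2 * q ^ 6 + q ^ 5 - 5 * q ^ 4 + 2 * q ^ 3 - 3 * q ^ 2) / 6 := by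
  have hc : (q ^ 3 - 1) * (q ^ 3 - q) * (q ^ 3 - q ^ 2) ≠ 0 := by
    have h1 : q ^ 3 - 1 ≠ 0 := by nlinarith [sq_nonneg q]
    have h2 : q ^ 3 - q ≠ 0 := by nlinarith [sq_nonneg q]
    have h3 : q ^ 3 - q ^ 2 ≠ 0 := by nlinarith [sq_nonneg q]
    exact mul_ne_zero (mul_ne_zero h1 h2) h3
  have g6 : G6 = (q ^ 3 + 1) * (q ^ 4 + q ^ 3 + q ^ 2 + q + 1) * (q ^ 2 + 1) := by
    apply mul_right_cancel₀ hc; rw [h6]; ring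
  have g5 : G5 = (q ^ 4 + q ^ 3 + q ^ 2 + q + 1) * (q ^ 2 + 1) := by
    apply mul_right_cancel₀ hc; rw [h5]; ring
  have g4 : G4 = q ^ 3 + q ^ 2 + q + 1 := by
    apply mul_right_cancel₀ hc; rw [h4]; ring
  subst g6 g5 g4 hn
  have hL : NL = q ^ 2 + q + 1 := by
    have : (q + 1) * q ≠ 0 := by positivity
    apply mul_left_cancel₀ this; rw [eL]; ring
  subst hL
  have r3 : N3 = (q ^ 6 + 2 * q ^ 5 + 2 * q ^ 4 + q ^ 3) / 6 := by linear_combination e3 / 6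
  subst r3
  have r2 : N2 = (q ^ 7 + 2 * q ^ 6 + 3 * q ^ 5 + 3 * q ^ 4 + 2 * q ^ 3 + q ^ 2) / 2 := by
    linear_combination e2 / 2
  subst r2
  have r1 : N1 = (2 * q ^ 8 + 2 * q ^ 7 + 3 * q ^ 6 + 2 * q ^ 5 + 4 * q ^ 4 + 3 * q ^ 3
      + 2 * q ^ 2) / 2 := by
    linear_combination e1
  subst r1
  refine ⟨rfl, rfl, rfl, rfl, ?_⟩
  linear_combination e0

theorem veronese_spectrum_dim_three
    {F : Type*} [Field F] [Fintype F] (q : ℕ) (hq : Fintype.card F = q) (hq4 : 4 ≤ q)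
    (rep : Plane F → (Fin 3 → F))
    (hrep : ∀ p : Plane F, ∃ h : rep p ≠ 0, Projectivization.mk F (rep p) h = p) :
    (hwSpectrum rep 3 (q ^ 2) : ℚ) = (q : ℚ) ^ 2 + q + 1 ∧
    (hwSpectrum rep 3 (q ^ 2 + q - 2) : ℚ) =
      ((q : ℚ) ^ 6 + 2 * q ^ 5 + 2 * q ^ 4 + q ^ 3) / 6 ∧
    (hwSpectrum rep 3 (q ^ 2 + q - 1) : ℚ) =
      ((q : ℚ) ^ 7 + 2 * q ^ 6 + 3 * q ^ 5 + 3 * q ^ 4 + 2 * q ^ 3 + q ^ 2) / 2 ∧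
    (hwSpectrum rep 3 (q ^ 2 + q) : ℚ) =
      (2 * (q : ℚ) ^ 8 + 2 * q ^ 7 + 3 * q ^ 6 + 2 * q ^ 5 + 4 * q ^ 4 + 3 * q ^ 3 + 2 * q ^ 2) / 2 ∧
    (hwSpectrum rep 3 (q ^ 2 + q + 1) : ℚ) =
      (6 * (q : ℚ) ^ 9 + 3 * q ^ 7 + 2 * q ^ 6 + q ^ 5 - 5 * q ^ 4 + 2 * q ^ 3 - 3 * q ^ 2) / 6 ∧
    ∀ w : ℕ, w ∉ ({q ^ 2, q ^ 2 + q - 2, q ^ 2 + q - 1, q ^ 2 + q, q ^ 2 + q + 1} : Set ℕ) →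
      hwSpectrum rep 3 w = 0 := by
  classical
  subst hq
  set q := Fintype.card F with hqdef
  have : Fintype (Plane F) := Fintype.ofFinite _
  have : Fintype (Submodule F (Plane F → F)) := Fintype.ofFinite _
  have hn : Fintype.card (Plane F) = q ^ 2 + q + 1 := by
    have hc : Nat.card (Plane F) = ∑ i ∈ Finset.range 3, Nat.card F ^ i :=
      Projectivization.card_of_finrank F _ (by simp)
    rw [← Nat.card_eq_fintype_card, hc, Nat.card_eq_fintype_card]
    simp only [Finset.sum_range_succ, Finset.sum_range_zero]
    ring
  let X : Finset (Submodule F (Plane F → F)) :=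
    Finset.univ.filter fun D => D ≤ VeroneseCode rep ∧ Module.finrank F D = 3
  have hX : ∀ D, D ∈ X ↔ D ≤ VeroneseCode rep ∧ Module.finrank F D = 3 := fun D => by simp [X]
  let B : Submodule F (Plane F → F) → Finset (Plane F) :=
    fun D => Finset.univ.filter fun p => p ∈ baseSet D
  have hB : ∀ D p, p ∈ B D ↔ p ∈ baseSet D := fun D p => by simp [B]
  have hBcard : ∀ D, (B D).card = (baseSet D).ncard := by
    intro D
    rw [← Set.ncard_coe_finset]
    congr 1
    ext p
    simp [B]
  -- weights
  have hwt : ∀ D : Submodule F (Plane F → F), wtSub D + (B D).card = q ^ 2 + q + 1 := by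
    intro D
    have : wtSub D = (Finset.univ.filter fun p => ¬ p ∈ baseSet D).card := by
      unfold wtSub
      have hs : {p | ∃ c ∈ D, c p ≠ 0} =
          ((Finset.univ.filter fun p => ¬ p ∈ baseSet D : Finset (Plane F)) : Set (Plane F)) := by
        ext p
        simp [baseSet]
      rw [hs]
      simp
    rw [this, add_comm, ← hn]
    exact Finset.card_filter_add_card_filter_not _
  have hspec : ∀ w, hwSpectrum rep 3 w = (X.filter fun D => wtSub D = w).card := by
    intro w
    unfold hwSpectrum
    rw [Nat.card_eq_fintype_card, Fintype.card_subtype, Finset.filter_filter]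
    congr 1
    ext D
    simp [and_assoc]
  -- counting through points
  have hcount : ∀ k ≤ 3, ∀ f : Fin k ↪ Plane F,
      (X.filter fun D => ∀ i, f i ∈ B D).card * ∏ i : Fin 3, (q ^ 3 - q ^ i.val) =
        ∏ i : Fin 3, (q ^ (6 - k) - q ^ i.val) := by
    intro k hk f
    have hfr := finrank_vanishAt rep hrep k hk f
    have := count_subspaces (vanishAt rep f) (by omega)
    rw [hfr] at this
    rw [← this]
    congr 1
    rw [Nat.card_eq_fintype_card, Fintype.card_subtype, Finset.filter_filter]
    congr 1
    ext D
    simp only [Finset.mem_filter, Finset.mem_univ, true_and, hB]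
    constructor
    · rintro ⟨⟨h1, h2⟩, h3⟩
      exact ⟨fun c hc => (mem_vanishAt rep f c).2 ⟨h1 hc, fun i => h3 i c hc⟩, h2⟩
    · rintro ⟨h1, h2⟩
      exact ⟨⟨fun c hc => ((mem_vanishAt rep f c).1 (h1 hc)).1, h2⟩,
        fun i c hc => ((mem_vanishAt rep f c).1 (h1 hc)).2 i⟩
  have hprod : 0 < ∏ i : Fin 3, (q ^ 3 - q ^ i.val) := by
    apply Finset.prod_pos
    intro i _
    have : q ^ i.val < q ^ 3 := Nat.pow_lt_pow_right (by omega) i.2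
    omega
  have hconst : ∀ k ≤ 3, ∃ m : ℕ, (∀ f : Fin k ↪ Plane F,
      (X.filter fun D => ∀ i, f i ∈ B D).card = m) ∧
      m * ∏ i : Fin 3, (q ^ 3 - q ^ i.val) = ∏ i : Fin 3, (q ^ (6 - k) - q ^ i.val) := by
    intro k hk
    have hne : Nonempty (Fin k ↪ Plane F) := by
      apply Function.Embedding.nonempty_of_card_le
      rw [hn, Fintype.card_fin]
      nlinarith
    obtain ⟨f0⟩ := hne
    refine ⟨_, fun f => ?_, hcount k hk f0⟩
    exact Nat.eq_of_mul_eq_mul_right hprod ((hcount k hk f).trans (hcount k hk f0).symm)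
  -- values of the base locus
  have hvals : ∀ D ∈ X, (B D).card = 0 ∨ (B D).card = 1 ∨ (B D).card = 2 ∨ (B D).card = 3 ∨
      (B D).card = q + 1 := by
    intro D hD
    by_cases h : (B D).card ≤ 2
    · omega
    · obtain ⟨p1, p2, p3, m1, m2, m3, h12, h13, h23⟩ :=
        Finset.two_lt_card_iff.1 (by omega : 2 < (B D).card)
      obtain ⟨D0, -, -, -, -, hD0, hu⟩ := line_exists rep hrep p1 p2 h12
      rcases hu D ((hX D).1 hD).1 ((hX D).1 hD).2 ((hB _ _).1 m1) ((hB _ _).1 m2) p3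
        ((hB _ _).1 m3) h13.symm h23.symm with h | h
      · rw [hBcard, h, hD0]; simp [hqdef]
      · rw [hBcard, h]; simp
  -- lines
  have hline : ∀ f : Fin 2 ↪ Plane F,
      ((X.filter fun D => (B D).card = q + 1).filter fun D => ∀ i, f i ∈ B D).card = 1 := by
    intro f
    have h01 : f 0 ≠ f 1 := f.injective.ne (by decide)
    obtain ⟨D0, a1, a2, a3, a4, a5, hu⟩ := line_exists rep hrep _ _ h01
    rw [Finset.card_eq_one]
    refine ⟨D0, ?_⟩
    ext D
    simp only [Finset.mem_filter, Finset.mem_singleton, hX, Fin.forall_fin_two, hB, hBcard]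
    constructor
    · rintro ⟨⟨⟨b1, b2⟩, b3⟩, b4, b5⟩
      obtain ⟨p3, m3, hp3⟩ : ∃ p3 ∈ B D, p3 ∉ ({f 0, f 1} : Finset (Plane F)) := by
        apply Finset.exists_mem_notMem_of_card_lt_card
        rw [hBcard, b3]
        have := Finset.card_le_two (a := f 0) (b := f 1)
        omega
      simp only [Finset.mem_insert, Finset.mem_singleton, not_or] at hp3
      rcases hu D b1 b2 b4 b5 p3 ((hB _ _).1 m3) hp3.1 hp3.2 with h | h
      · exact h
      · omega
    · rintro rfl
      exact ⟨⟨⟨a1, a2⟩, a5⟩, a3, a4⟩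
  have dc : ∀ k m, (∀ f : Fin k ↪ Plane F, (X.filter fun D => ∀ i, f i ∈ B D).card = m) →
      _ := fun k m h => (sum_by_values X (fun D => (B D).card) q hq4 hvals
        (fun j => j.descFactorial k)).symm.trans (double_count X B k m h)
  obtain ⟨G6, c6, k6⟩ := hconst 0 (by omega)
  obtain ⟨G5, c5, k5⟩ := hconst 1 (by omega)
  obtain ⟨G4, c4, k4⟩ := hconst 2 (by omega)
  obtain ⟨G3, c3, k3⟩ := hconst 3 (by omega)
  have hG3 : G3 = 1 := Nat.eq_of_mul_eq_mul_right hprod (by rw [k3, one_mul])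
  subst hG3
  have E0 := dc 0 G6 c6
  have E1 := dc 1 G5 c5
  have E2 := dc 2 G4 c4
  have E3 := dc 3 1 c3
  have EL := double_count _ B 2 1 hline
  rw [Finset.sum_congr rfl (fun D hD => by rw [(Finset.mem_filter.1 hD).2]), Finset.sum_const,
    smul_eq_mul] at EL
  rw [hn] at E0 E1 E2 E3 EL
  generalize hN0 : (X.filter fun D => (B D).card = 0).card = N0 at *
  generalize hN1 : (X.filter fun D => (B D).card = 1).card = N1 at *
  generalize hN2 : (X.filter fun D => (B D).card = 2).card = N2 at *
  generalize hN3 : (X.filter fun D => (B D).card = 3).card = N3 at *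
  generalize hNL : (X.filter fun D => (B D).card = q + 1).card = NL at *
  have s6 := gauss_solve q G6 6 hq4 (by omega) k6
  have s5 := gauss_solve q G5 5 hq4 (by omega) k5
  have s4 := gauss_solve q G4 4 hq4 (by omega) k4
  simp [Nat.descFactorial] at E0 E1 E2 E3 EL
  have hqc : ((q - 1 : ℕ) : ℚ) = (q : ℚ) - 1 := by rw [Nat.cast_sub (by omega)]; simp
  have hqc2 : ((q ^ 2 + q - 1 : ℕ) : ℚ) = (q : ℚ) ^ 2 + q - 1 := by
    rw [Nat.cast_sub (by omega)]; simp
  apply_fun (fun n : ℕ => (n : ℚ)) at E0 E1 E2 E3 EL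
  push_cast [hqc, hqc2] at E0 E1 E2 E3 EL
  have hsol := solve_system q N0 N1 N2 N3 NL G6 G5 G4 (q ^ 2 + q + 1) (by exact_mod_cast hq4) rfl
    s6 s5 s4 (by linarith) (by linarith) (by linarith) (by linarith) (by linarith)
  obtain ⟨rL, r3, r2, r1, r0⟩ := hsol
  have hfin : ∀ w j, w + j = q ^ 2 + q + 1 →
      hwSpectrum rep 3 w = (X.filter fun D => (B D).card = j).card := by
    intro w j hwj
    rw [hspec]
    congr 1
    ext D
    have := hwt D
    simp only [Finset.mem_filter]
    constructor
    · rintro ⟨h1, h2⟩; exact ⟨h1, by omega⟩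
    · rintro ⟨h1, h2⟩; exact ⟨h1, by omega⟩
  refine ⟨?_, ?_, ?_, ?_, ?_, ?_⟩
  · rw [hfin _ (q + 1) (by omega), hNL, rL]
  · rw [hfin _ 3 (by omega), hN3, r3]
  · rw [hfin _ 2 (by omega), hN2, r2]
  · rw [hfin _ 1 (by omega), hN1, r1]
  · rw [hfin _ 0 (by omega), hN0, r0]
  · intro w hw
    rw [hspec, Finset.card_eq_zero, Finset.filter_eq_empty_iff]
    intro D hD hDw
    apply hw
    have h1 := hwt D
    simp only [Set.mem_insert_iff, Set.mem_singleton_iff]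
    rcases hvals D hD with h | h | h | h | h <;> rw [h, hDw] at h1 <;> omega
end
end
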